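/- arXiv:math/9808118 — 3 statements merged into one kernel-verified Lean document; each statement's English description precedes it below -/
import Mathlib

section
/- Let n, c be nonnegative integers and 1 ≤ r ≤ 2n+1. If r ≤ n then s_{2n+1}((c^r); x^{±1}) = Σ_{ν ⊆ (c^r)} sp_{2n}(ν; x^{±1}), and if r > n then s_{2n+1}((c^r); x^{±1}) = Σ_{ν ⊆ (c^{2n+1−r})} sp_{2n}(ν; x^{±1}), where the sums range over all partitions ν contained in the indicated rectangle; these are identities of Laurent polynomials in x_1,…,x_n. -/
open scoped Classical
open Finset

noncomputable section

/-- Complete homogeneous symmetric polynomial of degree `m` in the variables `x`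
(`0` for negative `m`). -/
def hpoly {R : Type} [CommRing R] {N : ℕ} (x : Fin N → R) (m : ℤ) : R :=
  if 0 ≤ m then
    ∑ f ∈ Finset.univ.filter (fun f : Fin m.toNat → Fin N => Monotone f), ∏ i, x (f i)
  else 0

/-- The Schur function `s(λ; x) = det(h_{λ_i-i+j})` (indices `1 ≤ i,j ≤ r`). -/
def schur {R : Type} [CommRing R] {N r : ℕ} (lam : Fin r → ℤ) (x : Fin N → R) : R :=
  Matrix.det (Matrix.of fun i j : Fin r =>
    hpoly x (lam i - ((i : ℕ) : ℤ) + ((j : ℕ) : ℤ)))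

/-- The formal symplectic character `sp(λ; x)`. -/
def spChar {R : Type} [CommRing R] {N r : ℕ} (lam : Fin r → ℤ) (x : Fin N → R) : R :=
  Matrix.det (Matrix.of fun i j : Fin r =>
    if (j : ℕ) = 0 then hpoly x (lam i - ((i : ℕ) : ℤ))
    else hpoly x (lam i - ((i : ℕ) : ℤ) + ((j : ℕ) : ℤ)) +
      hpoly x (lam i - ((i : ℕ) : ℤ) - ((j : ℕ) : ℤ)))

/-- The `N`-tuple of arguments `x_1, x_1⁻¹, x_2, x_2⁻¹, …` (a trailing `1` if `N` is odd). -/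
def xpm {R : Type} [CommRing R] (n N : ℕ) (x : Fin n → Rˣ) : Fin N → R := fun k =>
  if h : (k : ℕ) / 2 < n then
    (if (k : ℕ) % 2 = 0 then ((x ⟨(k : ℕ) / 2, h⟩ : Rˣ) : R)
     else (((x ⟨(k : ℕ) / 2, h⟩)⁻¹ : Rˣ) : R))
  else 1

theorem tau_exists (K : Type) [Field K] (j : ℕ) : ∃ p : Polynomial K, p.Monic ∧ p.natDegree = j ∧
    ∀ y : K, y ≠ 0 → p.eval (y + y⁻¹) = if j = 0 then 1 else y ^ j + y⁻¹ ^ j := by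
  induction j using Nat.strong_induction_on with
  | _ j ih =>
    match j, ih with
    | 0, _ => exact ⟨1, Polynomial.monic_one, by simp, by simp⟩
    | 1, _ => exact ⟨Polynomial.X, Polynomial.monic_X, by simp, by simp⟩
    | 2, _ =>
      refine ⟨Polynomial.X ^ 2 - Polynomial.C 2, Polynomial.monic_X_pow_sub_C _ (by norm_num),
        Polynomial.natDegree_X_pow_sub_C, ?_⟩
      intro y hy
      simp
      field_simp
      ring
    | j + 3, ih =>
      obtain ⟨p, hp, dp, ep⟩ := ih (j + 2) (by omega)
      obtain ⟨q, hq, dq, eq⟩ := ih (j + 1) (by omega)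
      have hlt : q.degree < (Polynomial.X * p).degree := by
        rw [Polynomial.degree_eq_natDegree hq.ne_zero, Polynomial.degree_eq_natDegree
          (Polynomial.monic_X.mul hp).ne_zero, Polynomial.Monic.natDegree_mul Polynomial.monic_X hp,
          dp, dq, Polynomial.natDegree_X]
        norm_cast
        omega
      refine ⟨Polynomial.X * p - q, (Polynomial.monic_X.mul hp).sub_of_left hlt, ?_, ?_⟩
      · rw [Polynomial.natDegree_sub_eq_left_of_natDegree_lt,
          Polynomial.Monic.natDegree_mul Polynomial.monic_X hp, dp, Polynomial.natDegree_X]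
        · omega
        · rw [Polynomial.Monic.natDegree_mul Polynomial.monic_X hp, dp, dq, Polynomial.natDegree_X]
          omega
      · intro y hy
        simp only [Polynomial.eval_sub, Polynomial.eval_mul, Polynomial.eval_X, ep y hy, eq y hy]
        simp
        field_simp
        ring

theorem det_q_field (K : Type) [Field K] {r : ℕ} (y : Fin (r + 1) → K) (hy : ∀ i, y i ≠ 0) :
    Matrix.det (Matrix.of fun i j : Fin (r + 1) => if (j : ℕ) = 0 then y i ^ r
      else y i ^ (r - (j : ℕ)) + y i ^ (r + (j : ℕ)))
    = ∏ i, ∏ j ∈ Finset.Ioi i, ((1 - y i * y j) * (y i - y j)) := by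
  choose p hm hd he using tau_exists K
  have h1 : (Matrix.of fun i j : Fin (r + 1) => if (j : ℕ) = 0 then y i ^ r
      else y i ^ (r - (j : ℕ)) + y i ^ (r + (j : ℕ))) = Matrix.of fun i j : Fin (r + 1) =>
        (y i) ^ r * (Matrix.of fun i j : Fin (r+1) => (p j).eval (y i + (y i)⁻¹)) i j := by
    ext i j
    simp only [Matrix.of_apply, he j (y i) (hy i)]
    split_ifs with h
    · simp
    · have := hy i
      have hj : (j : ℕ) ≤ r := by omega
      obtain ⟨d, hd⟩ := Nat.exists_eq_add_of_le hj
      have e1 : r - (j : ℕ) = d := by omega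
      have e2 : y i ^ r = y i ^ (j : ℕ) * y i ^ d := by rw [← pow_add, ← hd]
      rw [e1, pow_add, e2, inv_pow]
      field_simp
      ring
  have h2 : Matrix.projVandermonde (fun i => 1 + y i ^ 2) y = Matrix.of fun i j : Fin (r + 1) =>
        (y i) ^ r * (Matrix.vandermonde (fun i => y i + (y i)⁻¹)) i j := by
    ext i j
    rw [Matrix.projVandermonde_apply, Matrix.of_apply, Matrix.vandermonde_apply]
    have hj : (j : ℕ) ≤ r := by omega
    have h3 : r = j + j.rev.1 := by simp [Fin.val_rev]; omega
    have h4 : (1 + y i ^ 2) = y i * (y i + (y i)⁻¹) := by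
      have := hy i
      field_simp
      ring
    have h5 : y i ^ r = y i ^ (j : ℕ) * y i ^ (j.rev.1) := by rw [← pow_add, ← h3]
    rw [h4, mul_pow, h5]; ring
  rw [h1, Matrix.det_mul_column, ← Matrix.det_eval_matrixOfPolynomials_eq_det_vandermonde
    (fun i => y i + (y i)⁻¹) (fun j => p j) (fun i => hd i) (fun i => hm i),
    ← Matrix.det_mul_column, ← h2, Matrix.det_projVandermonde]
  refine Finset.prod_congr rfl fun i _ => Finset.prod_congr rfl fun j _ => ?_
  ring

theorem det_q (S : Type) [CommRing S] [IsDomain S] {r : ℕ} (y : Fin (r + 1) → S)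
    (hy : ∀ i, y i ≠ 0) :
    Matrix.det (Matrix.of fun i j : Fin (r + 1) => if (j : ℕ) = 0 then y i ^ r
      else y i ^ (r - (j : ℕ)) + y i ^ (r + (j : ℕ)))
    = ∏ i, ∏ j ∈ Finset.Ioi i, ((1 - y i * y j) * (y i - y j)) := by
  have hinj := IsFractionRing.injective S (FractionRing S)
  apply hinj
  have := det_q_field (FractionRing S) (fun i => algebraMap S (FractionRing S) (y i))
    (fun i h => hy i (hinj (by simpa using h)))
  rw [RingHom.map_det]
  simp only [map_prod, map_mul, map_sub, map_one]
  rw [← this]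
  congr 1
  ext i j
  simp only [RingHom.mapMatrix_apply, Matrix.map_apply, Matrix.of_apply]
  split_ifs <;> simp

/-- the interpolation identity -/
theorem interp_identity (S : Type) [CommRing S] [IsDomain S] {r : ℕ} (y : Fin (r + 1) → S)
    (hy : ∀ i, y i ≠ 0) (hy1 : ∀ i, y i + 1 ≠ 0) :
    ∑ i : Fin (r + 1), (-1) ^ (i : ℕ) * ((∏ j : Fin r, y (i.succAbove j)) * (1 - y i) *
        ∏ j : Fin r, (1 - y i * y (i.succAbove j))) *
        (Matrix.vandermonde (fun j => y (i.succAbove j))).det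
      = (1 - ∏ i, y i) * (Matrix.vandermonde y).det := by
  let P := ∏ i, y i
  let SS : Polynomial S := ∏ i, (Polynomial.X - Polynomial.C (y i))
  have hSm : SS.Monic := Polynomial.monic_prod_X_sub_C _ _
  have hSd : SS.natDegree = r + 1 := by
    simp [SS]
  let T : S → Polynomial S := fun w => SS /ₘ (Polynomial.X - Polynomial.C w)
  have hTd : ∀ w, (T w).natDegree = r := by
    intro w
    simp [T, Polynomial.natDegree_divByMonic _ (Polynomial.monic_X_sub_C w), hSd]
  have hTm : ∀ w, (T w).coeff r = 1 := by
    intro w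
    have := Polynomial.leadingCoeff_divByMonic_of_monic (p := SS) (Polynomial.monic_X_sub_C w)
      (by rw [Polynomial.degree_eq_natDegree hSm.ne_zero, hSd, Polynomial.degree_X_sub_C]; norm_cast; omega)
    rw [hSm.leadingCoeff, Polynomial.leadingCoeff] at this
    rw [← this, ← hTd w]
  have hTe : ∀ w i, y i - w ≠ 0 → (T w).eval (y i) = ∏ j : Fin r, (w - y (i.succAbove j)) := by
    intro w i hne
    have h := Polynomial.modByMonic_add_div SS (Polynomial.X - Polynomial.C w)
    rw [Polynomial.modByMonic_X_sub_C_eq_C_eval] at h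
    have h2 := congrArg (Polynomial.eval (y i)) h
    have h3 : SS.eval (y i) = 0 := by
      simp only [SS, Polynomial.eval_prod]
      exact Finset.prod_eq_zero (Finset.mem_univ i) (by simp)
    have h4 : SS.eval w = (w - y i) * ∏ j : Fin r, (w - y (i.succAbove j)) := by
      simp only [SS, Polynomial.eval_prod]
      rw [Fin.prod_univ_succAbove _ i]
      simp
    rw [h3, Polynomial.eval_add, Polynomial.eval_C, h4, Polynomial.eval_mul] at h2
    simp only [Polynomial.eval_sub, Polynomial.eval_X, Polynomial.eval_C] at h2
    apply mul_left_cancel₀ hne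
    linear_combination h2
  let E : Polynomial S := ∏ i, (1 - Polynomial.C (y i) * Polynomial.X)
  have hEd : E.natDegree ≤ r + 1 := by
    refine (Polynomial.natDegree_prod_le _ _).trans ?_
    refine (Finset.sum_le_card_nsmul _ _ 1 ?_).trans (by simp)
    intro i _
    refine (Polynomial.natDegree_sub_le _ _).trans ?_
    simp only [Polynomial.natDegree_one, zero_le, sup_of_le_right]
    exact (Polynomial.natDegree_C_mul_le _ _).trans Polynomial.natDegree_X_le
  let Q : Polynomial S := E /ₘ (Polynomial.X - Polynomial.C (-1))
  have hQd : Q.natDegree ≤ r := by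
    simp only [Q, Polynomial.natDegree_divByMonic _ (Polynomial.monic_X_sub_C (-1 : S)),
      Polynomial.natDegree_X_sub_C]
    omega
  have hQ : E = Polynomial.C (E.eval (-1)) + (Polynomial.X - Polynomial.C (-1)) * Q := by
    have h := Polynomial.modByMonic_add_div E (Polynomial.X - Polynomial.C (-1))
    rw [Polynomial.modByMonic_X_sub_C_eq_C_eval] at h
    exact h.symm
  let Q1 := Q.divX
  have hQ1 : Q = Q1 * Polynomial.X + Polynomial.C (Q.coeff 0) := (Polynomial.divX_mul_X_add Q).symm
  have hE0 : E.eval 0 = 1 := by simp [E, Polynomial.eval_prod]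
  have hEm : E.eval (-1) = ∏ i, (1 + y i) := by simp [E, Polynomial.eval_prod]
  have hQ0 : Q.coeff 0 + E.eval (-1) = 1 := by
    have := congrArg (Polynomial.eval 0) hQ
    rw [hE0] at this
    simp [← Polynomial.coeff_zero_eq_eval_zero] at this
    linear_combination -this
  let g : Fin (r + 1) → S := fun i => (∏ j : Fin r, y (i.succAbove j)) * (1 - y i) *
        ∏ j : Fin r, (1 - y i * y (i.succAbove j))
  let p : Polynomial S := Polynomial.C ((-1) ^ r) * T 0 - Polynomial.C (P * (-1) ^ r) * T (-1)
    + Polynomial.C P * Q1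
  have hpg : ∀ i, p.eval (y i) = g i := by
    intro i
    have hne : y i - 0 ≠ 0 := by simpa using hy i
    have hne1 : y i - (-1) ≠ 0 := by simpa using hy1 i
    have hP : P = y i * ∏ j : Fin r, y (i.succAbove j) := Fin.prod_univ_succAbove _ i
    have hEy : E.eval (y i) = (1 - y i) * (1 + y i) * ∏ j : Fin r, (1 - y i * y (i.succAbove j)) := by
      simp only [E, Polynomial.eval_prod]
      rw [Fin.prod_univ_succAbove _ i]
      simp only [Polynomial.eval_sub, Polynomial.eval_one, Polynomial.eval_mul, Polynomial.eval_C,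
        Polynomial.eval_X]
      rw [Finset.prod_congr rfl (fun j _ => by rw [mul_comm (y (i.succAbove j))])]
      ring
    have hEm' : E.eval (-1) = (1 + y i) * ∏ j : Fin r, (1 + y (i.succAbove j)) := by
      rw [hEm, Fin.prod_univ_succAbove _ i]
    have e1 : E.eval (y i) = E.eval (-1) + (y i + 1) * Q.eval (y i) := by
      conv_lhs => rw [hQ]
      simp
    have e2 : Q.eval (y i) = Q1.eval (y i) * y i + Q.coeff 0 := by
      conv_lhs => rw [hQ1]
      simp
    have t0 : (-1) ^ r * (T 0).eval (y i) = ∏ j : Fin r, y (i.succAbove j) := by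
      rw [hTe 0 i hne]
      simp only [zero_sub, Finset.prod_neg]
      rw [Finset.card_univ, Fintype.card_fin, ← mul_assoc, ← mul_pow]
      simp
    have t1 : (-1) ^ r * (T (-1)).eval (y i) = ∏ j : Fin r, (1 + y (i.succAbove j)) := by
      rw [hTe (-1) i hne1, Finset.prod_congr rfl (fun j _ => show -1 - y (i.succAbove j) =
        -(1 + y (i.succAbove j)) by ring), Finset.prod_neg]
      rw [Finset.card_univ, Fintype.card_fin, ← mul_assoc, ← mul_pow]
      simp
    have : p.eval (y i) = (-1) ^ r * (T 0).eval (y i) - P * ((-1) ^ r * (T (-1)).eval (y i))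
        + P * Q1.eval (y i) := by
      simp [p, mul_assoc]
    rw [this, t0, t1]
    simp only [g]
    generalize (∏ j : Fin r, y (i.succAbove j)) = A at *
    generalize (∏ j : Fin r, (1 + y (i.succAbove j))) = B at *
    generalize ∏ j : Fin r, (1 - y i * y (i.succAbove j)) = D at *
    apply mul_left_cancel₀ (hy1 i)
    have key : (1 - y i) * (1 + y i) * D =
      (1 + y i) * B + (y i + 1) * (Q1.eval (y i) * y i + (1 - (1 + y i) * B)) := by
      rw [← hEy, e1, e2, ← hEm']
      linear_combination (y i + 1) * hQ0
    rw [hP]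
    linear_combination (-A) * key
  have hpd : p.natDegree ≤ r := by
    refine (Polynomial.natDegree_add_le _ _).trans (max_le ((Polynomial.natDegree_sub_le _ _).trans (max_le ?_ ?_)) ?_)
    · exact (Polynomial.natDegree_C_mul_le _ _).trans (hTd 0).le
    · exact (Polynomial.natDegree_C_mul_le _ _).trans (hTd _).le
    · refine (Polynomial.natDegree_C_mul_le _ _).trans ?_
      simp only [Q1, Polynomial.natDegree_divX_eq_natDegree_tsub_one]
      omega
  have hpc : p.coeff r = (-1) ^ r * (1 - P) := by
    have : Q1.coeff r = 0 := by
      simp only [Q1, Polynomial.coeff_divX]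
      exact Polynomial.coeff_eq_zero_of_natDegree_lt (by omega)
    simp only [p, Polynomial.coeff_add, Polynomial.coeff_sub, Polynomial.coeff_C_mul, hTm, this]
    ring
  let pp : Fin (r + 1) → Polynomial S := fun j => if j = Fin.last r then p else Polynomial.X ^ (j : ℕ)
  have hppd : ∀ j, (pp j).natDegree ≤ j := by
    intro j
    simp only [pp]
    split_ifs with h
    · subst h; simpa using hpd
    · simp
  have hM := Matrix.eval_matrixOfPolynomials_eq_vandermonde_mul_matrixOfPolynomials y pp hppd
  have hdet := congrArg Matrix.det hM
  rw [Matrix.det_mul, Matrix.det_of_isUpperTriangular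
    (Matrix.matrixOfPolynomials_blockTriangular pp hppd), Fin.prod_univ_castSucc,
    Matrix.det_succ_column _ (Fin.last r)] at hdet
  have hc1 : ∀ i : Fin r, (pp i.castSucc).coeff (i.castSucc : ℕ) = 1 := by
    intro i
    simp [pp, (Fin.castSucc_lt_last i).ne]
  have hc2 : (pp (Fin.last r)).coeff (Fin.last r : ℕ) = (-1) ^ r * (1 - P) := by
    simp [pp, hpc]
  simp only [Matrix.of_apply] at hdet
  rw [Finset.prod_congr rfl (fun i _ => hc1 i), hc2, Finset.prod_const_one, one_mul] at hdet
  have hsq : ((-1 : S) ^ r) * (-1) ^ r = 1 := by rw [← mul_pow]; simp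
  calc _ = (-1) ^ r * ∑ i : Fin (r + 1), (-1) ^ ((i : ℕ) + ((Fin.last r : Fin (r + 1)) : ℕ)) * (pp (Fin.last r)).eval (y i) * Matrix.det ((Matrix.of fun i j => (pp j).eval (y i)).submatrix i.succAbove (Fin.last r).succAbove) := by
        rw [Finset.mul_sum]
        refine Finset.sum_congr rfl fun i _ => ?_
        have : (pp (Fin.last r)).eval (y i) = g i := by simp [pp, hpg]
        rw [this, pow_add, Fin.val_last]
        have h5 : ((Matrix.of fun i j => (pp j).eval (y i)).submatrix i.succAbove (Fin.last r).succAbove) = Matrix.vandermonde (fun j => y (i.succAbove j)) := by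
          ext a b
          simp [pp, (Fin.castSucc_lt_last b).ne]
        rw [h5]
        simp only [g]
        linear_combination (-(-1) ^ (i : ℕ) * ((∏ j : Fin r, y (i.succAbove j)) * (1 - y i) *
        ∏ j : Fin r, (1 - y i * y (i.succAbove j))) *
        (Matrix.vandermonde (fun j => y (i.succAbove j))).det) * hsq
    _ = _ := by
        rw [hdet]
        simp only [P]
        linear_combination (1 - ∏ i, y i) * (Matrix.vandermonde y).det * hsq
/-- alternating sign of a tuple -/
def phi {r : ℕ} (p : Fin r → ℕ) : ℤ :=
  ∏ i : Fin r, ∏ j ∈ Finset.Ioi i, Int.sign ((p j : ℤ) - p i)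

theorem phi_perm {r : ℕ} (p : Fin r → ℕ) (σ : Equiv.Perm (Fin r)) :
    phi (fun i => p (σ i)) = (Equiv.Perm.sign σ : ℤ) * phi p := by
  have := σ.prod_Ioi_comp_eq_sign_mul_prod (R := ℤ)
    (f := fun i j => Int.sign ((p j : ℤ) - p i)) (by
      intro i j
      rw [← Int.sign_neg]; congr 1; ring)
  exact this

theorem phi_strictMono {r : ℕ} (p : Fin r → ℕ) (hp : StrictMono p) : phi p = 1 := by
  refine Finset.prod_eq_one fun i _ => Finset.prod_eq_one fun j hj => ?_
  have := hp (Finset.mem_Ioi.1 hj)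
  exact Int.sign_eq_one_of_pos (by omega)

theorem phi_eq_zero {r : ℕ} (p : Fin r → ℕ) (i j : Fin r) (hij : i ≠ j) (h : p i = p j) :
    phi p = 0 := by
  rcases lt_or_gt_of_ne hij with h1 | h1
  · exact Finset.prod_eq_zero (Finset.mem_univ i)
      (Finset.prod_eq_zero (Finset.mem_Ioi.2 h1) (by simp [h]))
  · exact Finset.prod_eq_zero (Finset.mem_univ j)
      (Finset.prod_eq_zero (Finset.mem_Ioi.2 h1) (by simp [h]))

theorem phi_shift {r : ℕ} (p q : Fin r → ℕ) (h : ∀ i, p i = q i + 1) : phi p = phi q := by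
  unfold phi
  simp [h]

theorem phi_succ {r : ℕ} (p : Fin (r + 1) → ℕ) :
    phi p = (∏ j : Fin r, Int.sign ((p j.succ : ℤ) - p 0)) * phi (fun j => p j.succ) := by
  unfold phi
  rw [Fin.prod_univ_succ]
  simp only [Fin.prod_Ioi_zero, Fin.prod_Ioi_succ]

theorem phi_zero_at {r : ℕ} (p : Fin (r + 1) → ℕ) (i : Fin (r + 1)) (hi : p i = 0)
    (h : ∀ j, 0 < p (i.succAbove j)) :
    phi p = (-1) ^ (i : ℕ) * phi (fun j => p (i.succAbove j)) := by
  have h1 := phi_perm p (i.cycleRange.symm)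
  rw [phi_succ] at h1
  simp only [Fin.cycleRange_symm_zero, Fin.cycleRange_symm_succ, Equiv.Perm.sign_symm, Fin.sign_cycleRange, hi] at h1
  rw [Finset.prod_eq_one, one_mul] at h1
  · rw [h1, ← mul_assoc]
    push_cast
    rw [← mul_pow]
    simp
  · intro j _
    have := h j
    exact Int.sign_eq_one_of_pos (by omega)

/-- the alternating Littlewood series -/
def Phi (R : Type) [CommRing R] {N r : ℕ} (e : Fin r → Fin N) : MvPowerSeries (Fin N) R :=
  fun p => if ∀ a, a ∉ Set.range e → p a = 0 then ((phi (fun i => p (e i)) : ℤ) : R) else 0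
theorem pairs_perm {M : Type} [CommMonoid M] {r : ℕ} (f : Fin r → Fin r → M)
    (hf : ∀ i j, f i j = f j i) (σ : Equiv.Perm (Fin r)) :
    ∏ i, ∏ j ∈ Finset.Ioi i, f (σ i) (σ j) = ∏ i, ∏ j ∈ Finset.Ioi i, f i j := by
  rw [Finset.prod_sigma', Finset.prod_sigma']
  refine Finset.prod_bij' (fun x _ => ⟨min (σ x.1) (σ x.2), max (σ x.1) (σ x.2)⟩)
    (fun x _ => ⟨min (σ.symm x.1) (σ.symm x.2), max (σ.symm x.1) (σ.symm x.2)⟩) ?_ ?_ ?_ ?_ ?_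
  · rintro ⟨a, b⟩ h
    simp only [Finset.mem_sigma, Finset.mem_univ, Finset.mem_Ioi, true_and] at h ⊢
    simp [h.ne']
  · rintro ⟨a, b⟩ h
    simp only [Finset.mem_sigma, Finset.mem_univ, Finset.mem_Ioi, true_and] at h ⊢
    simp [h.ne']
  · rintro ⟨a, b⟩ h
    simp only [Finset.mem_sigma, Finset.mem_univ, Finset.mem_Ioi, true_and] at h
    rcases le_total (σ a) (σ b) with h1 | h1 <;> simp [h1, h.le]
  · rintro ⟨a, b⟩ h
    simp only [Finset.mem_sigma, Finset.mem_univ, Finset.mem_Ioi, true_and] at h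
    rcases le_total (σ.symm a) (σ.symm b) with h1 | h1 <;> simp [h1, h.le]
  · rintro ⟨a, b⟩ h
    rcases le_total (σ a) (σ b) with h1 | h1 <;> simp [h1, hf (σ b)]

theorem pairs_succAbove {M : Type} [CommMonoid M] {r : ℕ} (f : Fin (r + 1) → Fin (r + 1) → M)
    (hf : ∀ i j, f i j = f j i) (i : Fin (r + 1)) :
    ∏ a, ∏ b ∈ Finset.Ioi a, f a b = (∏ j, f i (i.succAbove j)) *
      ∏ a, ∏ b ∈ Finset.Ioi a, f (i.succAbove a) (i.succAbove b) := by
  rw [← pairs_perm f hf i.cycleRange.symm, Fin.prod_univ_succ]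
  simp only [Fin.prod_Ioi_zero, Fin.prod_Ioi_succ, Fin.cycleRange_symm_zero,
    Fin.cycleRange_symm_succ]

def indE {N r : ℕ} (e : Fin r → Fin N) : Fin N →₀ ℕ := ∑ j, Finsupp.single (e j) 1

theorem indE_apply {N r : ℕ} (e : Fin r → Fin N) (he : Function.Injective e) (i : Fin r) :
    indE e (e i) = 1 := by
  simp [indE, Finsupp.finsetSum_apply, Finsupp.single_apply, he.eq_iff]

theorem indE_apply_not {N r : ℕ} (e : Fin r → Fin N) (a : Fin N) (ha : a ∉ Set.range e) :
    indE e a = 0 := by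
  simp only [indE, Finsupp.finsetSum_apply, Finsupp.single_apply]
  refine Finset.sum_eq_zero fun j _ => if_neg fun h => ha ⟨j, h⟩

theorem indE_le {N r : ℕ} (e : Fin r → Fin N) (he : Function.Injective e) (p : Fin N →₀ ℕ) :
    indE e ≤ p ↔ ∀ i, 0 < p (e i) := by
  constructor
  · intro h i
    have := h (e i)
    rw [indE_apply e he] at this
    omega
  · intro h a
    by_cases ha : a ∈ Set.range e
    · obtain ⟨i, rfl⟩ := ha
      rw [indE_apply e he]
      exact h i
    · rw [indE_apply_not e a ha]; exact Nat.zero_le _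

theorem prod_X_eq (R : Type) [CommRing R] {N r : ℕ} (e : Fin r → Fin N) :
    ∏ j, (MvPowerSeries.X (e j) : MvPowerSeries (Fin N) R) = MvPowerSeries.monomial (indE e) 1 := by
  induction r with
  | zero => simp [indE, MvPowerSeries.monomial_zero_one]
  | succ r ih =>
    rw [Fin.prod_univ_succ, ih (fun j => e j.succ), MvPowerSeries.X,
      MvPowerSeries.monomial_mul_monomial]
    simp [indE, Fin.sum_univ_succ]

theorem coeff_Phi (R : Type) [CommRing R] {N r : ℕ} (e : Fin r → Fin N) (p : Fin N →₀ ℕ) :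
    MvPowerSeries.coeff p (Phi R e) =
      if ∀ a, a ∉ Set.range e → p a = 0 then ((phi (fun i => p (e i)) : ℤ) : R) else 0 := rfl

theorem Phi_rec (R : Type) [CommRing R] {N r : ℕ} (e : Fin (r + 1) → Fin N)
    (he : Function.Injective e) :
    (1 - ∏ j, MvPowerSeries.X (e j)) * Phi R e = ∑ i : Fin (r + 1), (-1) ^ (i : ℕ) *
      ((∏ j : Fin r, MvPowerSeries.X (e (i.succAbove j))) * Phi R (fun j => e (i.succAbove j))) := by
  have hs : ∀ i : Fin (r + 1), Function.Injective (fun j => e (i.succAbove j)) := fun i =>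
    he.comp Fin.succAbove_right_injective
  have hsr : ∀ i : Fin (r + 1), e i ∉ Set.range (fun j => e (i.succAbove j)) := by
    rintro i ⟨j, hj⟩
    exact Fin.succAbove_ne i j (he hj)
  have hpow : ∀ (i : ℕ) (f : MvPowerSeries (Fin N) R) (p : Fin N →₀ ℕ),
      MvPowerSeries.coeff p ((-1) ^ i * f) = (-1) ^ i * MvPowerSeries.coeff p f := by
    intro i f p
    rcases neg_one_pow_eq_or (MvPowerSeries (Fin N) R) i with h | h
    · rcases Nat.even_or_odd i with h' | h' <;> simp [h'.neg_one_pow]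
    · rcases Nat.even_or_odd i with h' | h' <;> simp [h'.neg_one_pow]
  ext p
  rw [sub_mul, one_mul, map_sub, map_sum, prod_X_eq, MvPowerSeries.coeff_monomial_mul]
  simp only [hpow, prod_X_eq R (fun j => e (Fin.succAbove _ j)), MvPowerSeries.coeff_monomial_mul,
    indE_le e he, indE_le _ (hs _), one_mul, coeff_Phi]
  by_cases h1 : ∀ a, a ∉ Set.range e → p a = 0
  swap
  · have h1' := h1
    push Not at h1
    obtain ⟨a, ha, hpa⟩ := h1
    have h2 : ∀ i : Fin (r + 1), a ∉ Set.range (fun j => e (i.succAbove j)) := by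
      rintro i ⟨j, hj⟩
      exact ha ⟨_, hj⟩
    rw [if_neg h1', if_neg (c := ∀ a, a ∉ Set.range e → (p - indE e) a = 0)]
    · rw [Finset.sum_eq_zero]
      · simp
      intro i _
      have hc : ¬ ∀ b, b ∉ Set.range (fun j => e (i.succAbove j)) →
          (p - indE (fun j => e (i.succAbove j))) b = 0 := by
        intro h
        have := h a (h2 i)
        rw [Finsupp.tsub_apply, indE_apply_not _ a (h2 i)] at this
        omega
      simp only [if_neg hc, ite_self, mul_zero]
    · intro h
      have := h a ha
      rw [Finsupp.tsub_apply, indE_apply_not e a ha] at this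
      omega
  rw [if_pos h1]
  by_cases h2 : ∀ i, 0 < p (e i)
  · rw [if_pos h2, if_pos, phi_shift (fun i => p (e i)) (fun i => (p - indE e) (e i)), sub_self]
    · rw [Finset.sum_eq_zero]
      intro i _
      have hc : ¬ ∀ b, b ∉ Set.range (fun j => e (i.succAbove j)) →
          (p - indE (fun j => e (i.succAbove j))) b = 0 := by
        intro h
        have := h (e i) (hsr i)
        rw [Finsupp.tsub_apply, indE_apply_not _ _ (hsr i)] at this
        have := h2 i
        omega
      simp only [if_neg hc, ite_self, mul_zero]
    · intro i
      have := h2 i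
      rw [Finsupp.tsub_apply, indE_apply e he]
      omega
    · intro a ha
      rw [Finsupp.tsub_apply, h1 a ha, Nat.zero_sub]
  · rw [if_neg h2, sub_zero]
    push Not at h2
    obtain ⟨i, hi⟩ := h2
    have hi : p (e i) = 0 := by omega
    rw [Finset.sum_eq_single i]
    · by_cases h3 : ∀ j, 0 < p (e (i.succAbove j))
      · rw [if_pos h3, if_pos, phi_zero_at (fun i => p (e i)) i hi h3,
          phi_shift (fun j => p (e (i.succAbove j)))
            (fun j => (p - indE (fun j => e (i.succAbove j))) (e (i.succAbove j)))]
        · push_cast; rfl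
        · intro j
          have := h3 j
          rw [Finsupp.tsub_apply, indE_apply (fun j => e (i.succAbove j)) (hs i) j]
          omega
        · intro a ha
          by_cases hae : a ∈ Set.range e
          · obtain ⟨k, rfl⟩ := hae
            have : k = i := by
              by_contra hk
              obtain ⟨j, hj⟩ := Fin.exists_succAbove_eq hk
              exact ha ⟨j, by simp [hj]⟩
            rw [Finsupp.tsub_apply, this, hi, Nat.zero_sub]
          · rw [Finsupp.tsub_apply, h1 a hae, Nat.zero_sub]
      · rw [if_neg h3]
        push Not at h3
        obtain ⟨j, hj⟩ := h3
        rw [phi_eq_zero (fun i => p (e i)) i (i.succAbove j) (Fin.succAbove_ne i j).symm (by omega)]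
        simp
    · intro k _ hk
      rw [if_neg, mul_zero]
      intro h
      obtain ⟨j, hj⟩ := Fin.exists_succAbove_eq hk.symm
      have := h j
      rw [hj] at this
      omega
    · simp

theorem Phi_littlewood (R : Type) [CommRing R] [IsDomain R] {N : ℕ} (r : ℕ) (e : Fin r → Fin N)
    (he : Function.Injective e) :
    Phi R e * ((∏ i, (1 - MvPowerSeries.X (e i))) *
      ∏ i, ∏ j ∈ Finset.Ioi i, (1 - MvPowerSeries.X (e i) * MvPowerSeries.X (e j)))
    = (Matrix.vandermonde (fun i => (MvPowerSeries.X (e i) : MvPowerSeries (Fin N) R))).det := by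
  have : IsDomain (MvPowerSeries (Fin N) R) := NoZeroDivisors.to_isDomain _
  induction r with
  | zero =>
    simp
    ext p
    rw [coeff_Phi, MvPowerSeries.coeff_one]
    have : (∀ a, a ∉ Set.range e → p a = 0) ↔ p = 0 := by
      constructor
      · intro h
        ext a
        exact h a (by simp)
      · rintro rfl; simp
    simp only [this, phi]
    simp
  | succ r ih =>
    have hs : ∀ i : Fin (r + 1), Function.Injective (fun j => e (i.succAbove j)) := fun i =>
      he.comp Fin.succAbove_right_injective
    have hcc : ∀ i, MvPowerSeries.constantCoeff (MvPowerSeries.X (e i) : MvPowerSeries (Fin N) R) = 0 := by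
      intro i; simp
    have hP : (1 - ∏ j, (MvPowerSeries.X (e j) : MvPowerSeries (Fin N) R)) ≠ 0 := by
      intro h
      have := congrArg MvPowerSeries.constantCoeff h
      rw [map_sub, map_prod] at this
      simp at this
    apply mul_left_cancel₀ hP
    rw [← mul_assoc, Phi_rec R e he, ← interp_identity _ (fun i => (MvPowerSeries.X (e i) : MvPowerSeries (Fin N) R)),
      Finset.sum_mul]
    · refine Finset.sum_congr rfl fun i _ => ?_
      rw [← ih _ (hs i), Fin.prod_univ_succAbove (fun i => (1 - (MvPowerSeries.X (e i) : MvPowerSeries (Fin N) R))) i,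
        pairs_succAbove (fun a b => (1 - (MvPowerSeries.X (e a) : MvPowerSeries (Fin N) R) * MvPowerSeries.X (e b)))
         (fun a b => by rw [mul_comm]) i]
      ring
    · intro i h
      have := congrArg (MvPowerSeries.coeff (Finsupp.single (e i) 1)) h
      simp [MvPowerSeries.coeff_X] at this
    · intro i h
      have := congrArg MvPowerSeries.constantCoeff h
      simp at this
/-- product of one-variable series in separate variables -/
def TT {R : Type} [CommRing R] {r : ℕ} (f : Fin r → PowerSeries R) : MvPowerSeries (Fin r) R :=
  fun p => ∏ i, PowerSeries.coeff (p i) (f i)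

theorem coeff_TT {R : Type} [CommRing R] {r : ℕ} (f : Fin r → PowerSeries R) (p : Fin r →₀ ℕ) :
    MvPowerSeries.coeff p (TT f) = ∏ i, PowerSeries.coeff (p i) (f i) := rfl

theorem TT_mul {R : Type} [CommRing R] {r : ℕ} (f g : Fin r → PowerSeries R) :
    TT (f * g) = TT f * TT g := by
  ext p
  rw [MvPowerSeries.coeff_mul, coeff_TT]
  simp only [Pi.mul_apply, PowerSeries.coeff_mul, coeff_TT, ← Finset.prod_mul_distrib]
  rw [Finset.prod_univ_sum]
  symm
  refine Finset.sum_bij' (fun x _ => fun i => (x.1 i, x.2 i))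
    (fun x _ => (Finsupp.equivFunOnFinite.symm fun i => (x i).1,
      Finsupp.equivFunOnFinite.symm fun i => (x i).2)) ?_ ?_ ?_ ?_ ?_
  · rintro ⟨a, b⟩ h
    rw [Finset.HasAntidiagonal.mem_antidiagonal] at h
    rw [Fintype.mem_piFinset]
    intro i
    rw [Finset.HasAntidiagonal.mem_antidiagonal, ← h]
    rfl
  · intro x h
    rw [Fintype.mem_piFinset] at h
    rw [Finset.HasAntidiagonal.mem_antidiagonal]
    ext i
    have := Finset.HasAntidiagonal.mem_antidiagonal.1 (h i)
    simpa using this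
  · rintro ⟨a, b⟩ h
    ext <;> simp
  · intro x h
    ext <;> simp
  · intro x h
    rfl

theorem TT_one {R : Type} [CommRing R] {r : ℕ} : TT (1 : Fin r → PowerSeries R) = 1 := by
  ext p
  rw [coeff_TT, MvPowerSeries.coeff_one]
  simp only [Pi.one_apply, PowerSeries.coeff_one]
  rw [Finset.prod_ite_zero]
  simp [Finsupp.ext_iff]

def TTHom (R : Type) [CommRing R] (r : ℕ) : (Fin r → PowerSeries R) →* MvPowerSeries (Fin r) R where
  toFun := TT
  map_one' := TT_one
  map_mul' := TT_mul

theorem coeff_TT_single {R : Type} [CommRing R] {r : ℕ} (i : Fin r) (f : PowerSeries R)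
    (p : Fin r →₀ ℕ) : MvPowerSeries.coeff p (TT (Pi.mulSingle i f)) =
      PowerSeries.coeff (p i) f * ∏ k ∈ Finset.univ.erase i, if p k = 0 then 1 else 0 := by
  rw [coeff_TT, ← Finset.mul_prod_erase _ _ (Finset.mem_univ i)]
  simp only [Pi.mulSingle_eq_same]
  congr 1
  refine Finset.prod_congr rfl fun k hk => ?_
  rw [Pi.mulSingle_eq_of_ne (Finset.ne_of_mem_erase hk), PowerSeries.coeff_one]

def iota (R : Type) [CommRing R] {r : ℕ} (i : Fin r) : PowerSeries R →+* MvPowerSeries (Fin r) R where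
  toFun f := TT (Pi.mulSingle i f)
  map_one' := by rw [Pi.mulSingle_one, TT_one]
  map_mul' f g := by rw [Pi.mulSingle_mul, TT_mul]
  map_zero' := by
    ext p
    rw [coeff_TT_single]; simp
  map_add' f g := by
    ext p
    rw [map_add]
    simp only [coeff_TT_single, map_add, add_mul]

theorem iota_X {R : Type} [CommRing R] {r : ℕ} (i : Fin r) :
    iota R i PowerSeries.X = MvPowerSeries.X i := by
  ext p
  change MvPowerSeries.coeff p (TT (Pi.mulSingle i _)) = _
  rw [coeff_TT_single, MvPowerSeries.coeff_X, PowerSeries.coeff_X, Finset.prod_ite_zero]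
  have : p = Finsupp.single i 1 ↔ p i = 1 ∧ ∀ k ∈ Finset.univ.erase i, p k = 0 := by
    constructor
    · rintro rfl
      refine ⟨by simp, fun k hk => ?_⟩
      simp [(Finset.ne_of_mem_erase hk).symm]
    · rintro ⟨h1, h2⟩
      ext k
      by_cases hk : k = i
      · subst hk; simp [h1]
      · rw [h2 k (by simp [hk]), Finsupp.single_apply, if_neg (Ne.symm hk)]
  simp only [this]
  by_cases h1 : p i = 1 <;> by_cases h2 : ∀ k ∈ Finset.univ.erase i, p k = 0 <;> simp [h1]

theorem prod_iota {R : Type} [CommRing R] {r : ℕ} (f : Fin r → PowerSeries R) :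
    ∏ i, iota R i (f i) = TT f := by
  have := map_prod (TTHom R r) (fun i => Pi.mulSingle i (f i)) Finset.univ
  rw [Finset.univ_prod_mulSingle] at this
  exact this.symm

theorem coeff_det_iota {R : Type} [CommRing R] {r : ℕ} (f : Fin r → Fin r → PowerSeries R)
    (p : Fin r →₀ ℕ) :
    MvPowerSeries.coeff p (Matrix.det (Matrix.of fun i j => iota R i (f i j))) =
      Matrix.det (Matrix.of fun i j => PowerSeries.coeff (p i) (f i j)) := by
  rw [← Matrix.det_transpose, Matrix.det_apply, ← Matrix.det_transpose (Matrix.of fun i j => PowerSeries.coeff (p i) (f i j)), Matrix.det_apply, map_sum]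
  refine Finset.sum_congr rfl fun σ _ => ?_
  simp only [Matrix.transpose_apply, Matrix.of_apply]
  rw [prod_iota (fun i => f i (σ i)), Units.smul_def, Units.smul_def, map_zsmul, coeff_TT]

theorem sum_sort {M : Type} [AddCommMonoid M] (n K : ℕ) (f : (Fin n → ℕ) → M)
    (hperm : ∀ p (σ : Equiv.Perm (Fin n)), f (fun i => p (σ i)) = f p)
    (hinj : ∀ p, ¬ Function.Injective p → f p = 0) :
    ∑ p ∈ Fintype.piFinset (fun _ : Fin n => Finset.range K), f p =
      n.factorial • ∑ m ∈ (Fintype.piFinset (fun _ : Fin n => Finset.range K)).filter StrictMono,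
        f m := by
  have h1 : ∑ p ∈ Fintype.piFinset (fun _ : Fin n => Finset.range K), f p =
      ∑ p ∈ (Fintype.piFinset (fun _ : Fin n => Finset.range K)).filter Function.Injective, f p := by
    symm
    apply Finset.sum_filter_of_ne
    intro p _ h
    by_contra h'
    exact h (hinj p h')
  have h2 : ∑ p ∈ (Fintype.piFinset (fun _ : Fin n => Finset.range K)).filter Function.Injective, f p
      = ∑ x ∈ (Finset.univ : Finset (Equiv.Perm (Fin n))) ×ˢ
        (Fintype.piFinset (fun _ : Fin n => Finset.range K)).filter StrictMono, f x.2 := by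
    symm
    refine Finset.sum_bij' (fun x _ => fun i => x.2 (x.1 i))
      (fun p _ => ((Tuple.sort p)⁻¹, p ∘ Tuple.sort p)) ?_ ?_ ?_ ?_ ?_
    · rintro ⟨σ, m⟩ h
      simp only [Finset.mem_product, Finset.mem_univ, true_and, Finset.mem_filter,
        Fintype.mem_piFinset] at h ⊢
      exact ⟨fun i => h.1 _, h.2.injective.comp σ.injective⟩
    · intro p h
      simp only [Finset.mem_product, Finset.mem_univ, true_and, Finset.mem_filter,
        Fintype.mem_piFinset] at h ⊢
      exact ⟨fun i => h.1 _, (Tuple.monotone_sort p).strictMono_of_injective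
        (h.2.comp (Tuple.sort p).injective)⟩
    · rintro ⟨σ, m⟩ h
      simp only [Finset.mem_product, Finset.mem_univ, true_and, Finset.mem_filter,
        Fintype.mem_piFinset] at h
      have hm := h.2
      have hcomp : (fun i => m (σ i)) ∘ (σ⁻¹ : Equiv.Perm (Fin n)) = m := by
        ext i; simp
      have h3 := (Tuple.comp_sort_eq_comp_iff_monotone (f := fun i => m (σ i)) (σ := σ⁻¹)).2
        (by rw [hcomp]; exact hm.monotone)
      rw [hcomp] at h3
      have h4 : Tuple.sort (fun i => m (σ i)) = σ⁻¹ := by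
        ext i
        have := congrFun h3 i
        have := hm.injective (by simpa using this)
        rw [Equiv.Perm.eq_inv_iff_eq.2 this.symm]
      simp only [Prod.mk.injEq]
      refine ⟨by rw [h4, inv_inv], h3.symm⟩
    · intro p h
      ext i
      simp
    · rintro ⟨σ, m⟩ h
      exact (hperm m σ).symm
  rw [h1, h2, Finset.sum_product]
  simp [Finset.card_univ, Fintype.card_perm]
theorem strictMono_gap {k : ℕ} (m : Fin k → ℕ) (hm : StrictMono m) (i j : Fin k) (hij : i ≤ j) :
    m i + ((j : ℕ) - (i : ℕ)) ≤ m j := by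
  obtain ⟨a, ha⟩ := i
  obtain ⟨b, hb⟩ := j
  have hab : a ≤ b := hij
  clear hij
  induction b, hab using Nat.le_induction with
  | base => simp
  | succ b hab ih =>
    have h1 := ih (by omega)
    have h2 : m ⟨b, by omega⟩ < m ⟨b + 1, hb⟩ := hm (by simp)
    simp only at h1 ⊢
    omega

theorem coeff_X_pow_mul_mk {R : Type} [CommRing R] (H : ℤ → R) (hH : ∀ k, k < 0 → H k = 0)
    (a n : ℕ) : PowerSeries.coeff n (PowerSeries.X ^ a * PowerSeries.mk (fun k : ℕ => H k)) =
      H ((n : ℤ) - a) := by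
  rw [PowerSeries.coeff_X_pow_mul']
  split_ifs with h
  · rw [PowerSeries.coeff_mk]; congr 1; omega
  · rw [hH]; omega

theorem rect_dom (R : Type) [CommRing R] [IsDomain R] [CharZero R] (r c : ℕ) (H G : ℤ → R)
    (hH : ∀ k, k < 0 → H k = 0) (hG : ∀ k, k < 0 → G k = 0) (hGH : ∀ k, G k = H k + G (k - 1)) :
    Matrix.det (Matrix.of fun i j : Fin (r + 1) => G ((c : ℤ) - ((i : ℕ) : ℤ) + ((j : ℕ) : ℤ))) =
    ∑ ν ∈ ((Fintype.piFinset fun _ : Fin (r + 1) => Finset.range (c + 1)).filter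
              (fun ν => Antitone ν)),
      Matrix.det (Matrix.of fun i j : Fin (r + 1) =>
        if (j : ℕ) = 0 then H ((ν i : ℤ) - ((i : ℕ) : ℤ))
        else H ((ν i : ℤ) - ((i : ℕ) : ℤ) + ((j : ℕ) : ℤ)) +
          H ((ν i : ℤ) - ((i : ℕ) : ℤ) - ((j : ℕ) : ℤ))) := by
  have hdom : IsDomain (MvPowerSeries (Fin (r + 1)) R) := NoZeroDivisors.to_isDomain _
  let Hs : PowerSeries R := PowerSeries.mk (fun k : ℕ => H k)
  let Gs : PowerSeries R := PowerSeries.mk (fun k : ℕ => G k)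
  have hGs : Gs * (1 - PowerSeries.X) = Hs := by
    ext n
    have h1 := coeff_X_pow_mul_mk G hG 1 n
    rw [pow_one] at h1
    rw [mul_sub, mul_one, map_sub, mul_comm, h1, PowerSeries.coeff_mk, PowerSeries.coeff_mk, hGH n]
    simp
  let C : ℕ := c + r
  let Cv : Fin (r + 1) →₀ ℕ := Finsupp.equivFunOnFinite.symm (fun _ => C)
  let q : Fin (r + 1) → PowerSeries R := fun j => if (j : ℕ) = 0 then PowerSeries.X ^ r
      else PowerSeries.X ^ (r - (j : ℕ)) + PowerSeries.X ^ (r + (j : ℕ))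
  let D : (Fin (r + 1) → ℕ) → R := fun p => Matrix.det (Matrix.of fun i j : Fin (r + 1) =>
    if (j : ℕ) = 0 then H ((c : ℤ) - p i)
        else H ((c : ℤ) - p i + ((j : ℕ) : ℤ)) + H ((c : ℤ) - p i - ((j : ℕ) : ℤ)))
  let e : Fin (r + 1) → Fin (r + 1) := id
  let DD := Matrix.det (Matrix.of fun i j => iota R i (q j * Hs))
  let ys : Fin (r + 1) → MvPowerSeries (Fin (r + 1)) R := fun i => MvPowerSeries.X i
  -- first evaluation
  have eval1 : MvPowerSeries.coeff Cv (Phi R e * DD) =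
      ∑ p ∈ Fintype.piFinset (fun _ : Fin (r + 1) => Finset.range (C + 1)), (phi p : R) * D p := by
    rw [MvPowerSeries.coeff_mul]
    refine Finset.sum_bij' (fun x _ => fun i => x.1 i)
      (fun p _ => (Finsupp.equivFunOnFinite.symm p,
        Finsupp.equivFunOnFinite.symm fun i => C - p i)) ?_ ?_ ?_ ?_ ?_
    · rintro ⟨a, b⟩ h
      rw [Finset.HasAntidiagonal.mem_antidiagonal] at h
      rw [Fintype.mem_piFinset]
      intro i
      have := DFunLike.congr_fun h i
      simp [Cv] at this
      simp
      omega
    · intro p h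
      rw [Fintype.mem_piFinset] at h
      rw [Finset.HasAntidiagonal.mem_antidiagonal]
      ext i
      have := h i
      simp at this
      simp [Cv]
      omega
    · rintro ⟨a, b⟩ h
      rw [Finset.HasAntidiagonal.mem_antidiagonal] at h
      ext i
      · simp
      · have := DFunLike.congr_fun h i
        simp [Cv] at this
        simp
        omega
    · intro p h
      ext i; simp
    · rintro ⟨a, b⟩ h
      rw [Finset.HasAntidiagonal.mem_antidiagonal] at h
      simp only
      rw [coeff_Phi, if_pos (by simp [e]), coeff_det_iota]
      congr 1
      simp only [D]
      congr 1
      ext i j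
      have hb : ((b i : ℕ) : ℤ) = c + r - a i := by
        have := DFunLike.congr_fun h i
        simp [Cv, C] at this
        omega
      have hj : ((r - (j : ℕ) : ℕ) : ℤ) = r - (j : ℕ) := by omega
      simp only [Matrix.of_apply, q]
      split_ifs with h0
      · rw [coeff_X_pow_mul_mk H hH, hb]; congr 1; ring
      · rw [add_mul, map_add, coeff_X_pow_mul_mk H hH, coeff_X_pow_mul_mk H hH, hb, hj]
        push_cast
        congr 2 <;> ring
  -- second evaluation
  have hDD : Phi R e * DD = (Matrix.vandermonde ys).det *
      Matrix.det (Matrix.of fun i j : Fin (r + 1) => iota R i (PowerSeries.X ^ (r - (j : ℕ)) * Gs)) := by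
    have h1 : DD = (∏ i, iota R i Hs) * ∏ i, ∏ j ∈ Finset.Ioi i,
        ((1 - ys i * ys j) * (ys i - ys j)) := by
      rw [← det_q _ ys, ← Matrix.det_mul_column]
      · simp only [DD]
        congr 1
        ext1 i j
        simp only [Matrix.of_apply, map_mul, q]
        rw [mul_comm]
        congr 1
        split_ifs <;> simp [iota_X, ys]
      · intro i h
        have := congrArg (MvPowerSeries.coeff (Finsupp.single i 1)) h
        simp [ys, MvPowerSeries.coeff_X] at this
    have h2 : Matrix.det (Matrix.of fun i j : Fin (r + 1) => iota R i (PowerSeries.X ^ (r - (j : ℕ)) * Gs))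
        = (∏ i, iota R i Gs) * ∏ i, ∏ j ∈ Finset.Ioi i, (ys i - ys j) := by
      have h3 := Matrix.det_projVandermonde (fun _ => 1) ys
      simp only [one_mul] at h3
      rw [← h3, ← Matrix.det_mul_column]
      congr 1
      ext1 i j
      simp only [Matrix.of_apply, map_mul, Matrix.projVandermonde_apply, map_pow, iota_X, one_pow,
        one_mul, Fin.val_rev]
      rw [mul_comm]
      congr 2
      omega
    have h4 := Phi_littlewood R (r + 1) e Function.injective_id
    have h5 : (∏ i, iota R i Hs) = (∏ i, iota R i Gs) * ∏ i, (1 - ys i) := by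
      rw [← Finset.prod_mul_distrib, ← hGs]
      refine Finset.prod_congr rfl fun i _ => ?_
      simp [iota_X, ys]
    rw [h1, h2, h5]
    simp only [Finset.prod_mul_distrib]
    have h6 : (fun i => MvPowerSeries.X (e i)) = ys := rfl
    rw [h6] at h4
    rw [← h4]
    simp only [ys, e, id]
    ring
  have eval2 : MvPowerSeries.coeff Cv (Phi R e * DD) = ((r + 1).factorial : R) *
      Matrix.det (Matrix.of fun i j : Fin (r + 1) => G ((c : ℤ) - ((i : ℕ) : ℤ) + ((j : ℕ) : ℤ))) := by
    rw [hDD, ← Matrix.det_transpose (Matrix.vandermonde ys), Matrix.det_apply, Finset.sum_mul, map_sum]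
    have : ∀ σ : Equiv.Perm (Fin (r + 1)), MvPowerSeries.coeff Cv
        ((Equiv.Perm.sign σ • ∏ i, (Matrix.vandermonde ys).transpose (σ i) i) *
          Matrix.det (Matrix.of fun i j : Fin (r + 1) => iota R i (PowerSeries.X ^ (r - (j : ℕ)) * Gs)))
        = Matrix.det (Matrix.of fun i j : Fin (r + 1) =>
            G ((c : ℤ) - ((i : ℕ) : ℤ) + ((j : ℕ) : ℤ))) := by
      intro σ
      rw [smul_mul_assoc, ← Matrix.det_mul_column, Units.smul_def, map_zsmul]
      have h1 : (Matrix.of fun i j => (Matrix.vandermonde ys).transpose (σ i) i *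
          (Matrix.of fun i j : Fin (r + 1) => iota R i (PowerSeries.X ^ (r - (j : ℕ)) * Gs)) i j)
          = Matrix.of fun i j : Fin (r + 1) =>
            iota R i (PowerSeries.X ^ ((σ i : ℕ) + (r - (j : ℕ))) * Gs) := by
        ext1 i j
        simp only [Matrix.of_apply, Matrix.transpose_apply, Matrix.vandermonde_apply, map_mul,
          map_pow, iota_X, ys, pow_add]
        ring
      rw [h1, coeff_det_iota]
      have h2 : (Matrix.of fun i j : Fin (r + 1) => PowerSeries.coeff (Cv i)
          (PowerSeries.X ^ ((σ i : ℕ) + (r - (j : ℕ))) * Gs)) =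
          (Matrix.of fun i j : Fin (r + 1) =>
            G ((c : ℤ) - ((i : ℕ) : ℤ) + ((j : ℕ) : ℤ))).submatrix σ id := by
        ext i j
        simp only [Matrix.of_apply, Matrix.submatrix_apply, id]
        rw [coeff_X_pow_mul_mk G hG]
        congr 1
        simp [Cv, C]
        omega
      rw [h2, Matrix.det_permute, zsmul_eq_mul, ← mul_assoc]
      rw [← Int.cast_mul, ← Units.val_mul, Int.units_mul_self]
      simp
    rw [Finset.sum_congr rfl (fun σ _ => this σ)]
    simp [Finset.card_univ, Fintype.card_perm]
  have hDperm : ∀ p (σ : Equiv.Perm (Fin (r + 1))),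
      D (fun i => p (σ i)) = ((Equiv.Perm.sign σ : ℤ) : R) * D p := by
    intro p σ
    rw [← Matrix.det_permute]
    rfl
  have hsort := sum_sort (r + 1) (C + 1) (fun p => (phi p : R) * D p) (by
      intro p σ
      rw [hDperm, phi_perm, Int.cast_mul, mul_mul_mul_comm, ← Int.cast_mul, ← Units.val_mul,
        Int.units_mul_self]
      simp) (by
      intro p hp
      rw [Function.Injective] at hp
      push Not at hp
      obtain ⟨a, b, h1, h2⟩ := hp
      rw [phi_eq_zero p a b h2 h1]; simp)
  have hfact : ((r + 1).factorial : R) ≠ 0 := by exact_mod_cast Nat.factorial_ne_zero _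
  rw [← eval1, eval2, nsmul_eq_mul] at hsort
  rw [mul_left_cancel₀ hfact hsort]
  symm
  refine Finset.sum_bij' (fun ν _ => fun i => c - ν i + (i : ℕ))
    (fun m _ => fun i => c + (i : ℕ) - m i) ?_ ?_ ?_ ?_ ?_
  · intro ν h
    simp only [Finset.mem_filter, Fintype.mem_piFinset, Finset.mem_range] at h ⊢
    refine ⟨fun i => by have := h.1 i; have := i.2; simp only [C]; omega, fun i j hij => ?_⟩
    have := h.2 hij.le
    have h1 := h.1 i
    have h2 : (i : ℕ) < j := hij
    simp only
    omega
  · intro m h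
    simp only [Finset.mem_filter, Fintype.mem_piFinset, Finset.mem_range] at h ⊢
    refine ⟨fun i => ?_, fun i j hij => ?_⟩
    · have := strictMono_gap m h.2 0 i (Fin.zero_le _)
      simp at this
      omega
    · have := strictMono_gap m h.2 i j hij
      have h2 : (i : ℕ) ≤ j := hij
      simp only
      omega
  · intro ν h
    simp only [Finset.mem_filter, Fintype.mem_piFinset, Finset.mem_range] at h
    ext i
    have := h.1 i
    simp only
    omega
  · intro m h
    simp only [Finset.mem_filter, Fintype.mem_piFinset, Finset.mem_range] at h
    ext i
    have h1 := strictMono_gap m h.2 0 i (Fin.zero_le _)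
    have h2 := strictMono_gap m h.2 i (Fin.last r) (Fin.le_last _)
    have h3 := h.1 (Fin.last r)
    have h4 := i.2
    simp [C] at h1 h2 h3
    simp only
    omega
  · intro ν h
    simp only [Finset.mem_filter, Fintype.mem_piFinset, Finset.mem_range] at h
    rw [phi_strictMono]
    · rw [Int.cast_one, one_mul]
      simp only [D]
      congr 1
      ext i j
      have h1 := h.1 i
      have h2 : ((c - ν i + (i : ℕ) : ℕ) : ℤ) = c - ν i + (i : ℕ) := by omega
      simp only [Matrix.of_apply, h2]
      split_ifs
      · congr 1; ring
      · congr 2 <;> ring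
    · intro i j hij
      have := h.2 hij.le
      have h1 := h.1 i
      have h2 : (i : ℕ) < j := hij
      simp only
      omega

theorem rect_general (R : Type) [CommRing R] (r c : ℕ) (H G : ℤ → R)
    (hH : ∀ k, k < 0 → H k = 0) (hG : ∀ k, k < 0 → G k = 0) (hGH : ∀ k, G k = H k + G (k - 1)) :
    Matrix.det (Matrix.of fun i j : Fin r => G ((c : ℤ) - ((i : ℕ) : ℤ) + ((j : ℕ) : ℤ))) =
    ∑ ν ∈ ((Fintype.piFinset fun _ : Fin r => Finset.range (c + 1)).filter
              (fun ν => Antitone ν)),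
      Matrix.det (Matrix.of fun i j : Fin r =>
        if (j : ℕ) = 0 then H ((ν i : ℤ) - ((i : ℕ) : ℤ))
        else H ((ν i : ℤ) - ((i : ℕ) : ℤ) + ((j : ℕ) : ℤ)) +
          H ((ν i : ℤ) - ((i : ℕ) : ℤ) - ((j : ℕ) : ℤ))) := by
  rcases r with _ | r
  · simp only [Matrix.det_isEmpty]
    rw [Finset.sum_const, nsmul_eq_mul, mul_one]
    have : ((Fintype.piFinset fun _ : Fin 0 => Finset.range (c + 1)).filter
              (fun ν => Antitone ν)) = Finset.univ := by
      ext ν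
      simp only [Finset.mem_filter, Fintype.mem_piFinset, Finset.mem_univ, iff_true]
      exact ⟨fun i => i.elim0, fun i => i.elim0⟩
    rw [this]
    simp
  · let H' : ℤ → MvPolynomial ℤ ℤ := fun k => if k < 0 then 0 else MvPolynomial.X k
    let G' : ℤ → MvPolynomial ℤ ℤ := fun k => ∑ j ∈ Finset.range (k + 1).toNat, H' j
    let f : MvPolynomial ℤ ℤ →+* R := MvPolynomial.eval₂Hom (Int.castRingHom R) H
    have hf : ∀ k, f (H' k) = H k := by
      intro k
      simp only [H', f]
      split_ifs with h
      · rw [map_zero, hH k h]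
      · simp
    have hG'H : ∀ k, G' k = H' k + G' (k - 1) := by
      intro k
      simp only [G']
      by_cases h : k < 0
      · have h1 : (k + 1).toNat = 0 := by omega
        have h2 : (k - 1 + 1).toNat = 0 := by omega
        rw [h1, h2]
        simp [H', h]
      · have h1 : (k + 1).toNat = k.toNat + 1 := by omega
        have h2 : (k - 1 + 1).toNat = k.toNat := by omega
        have h3 : ((k.toNat : ℕ) : ℤ) = k := by omega
        rw [h1, h2, Finset.sum_range_succ, h3, add_comm]
    have hG' : ∀ k, k < 0 → G' k = 0 := by
      intro k h
      have h1 : (k + 1).toNat = 0 := by omega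
      simp only [G']
      rw [h1]; simp
    have hfG : ∀ k, f (G' k) = G k := by
      have key : ∀ t : ℕ, f (G' ((t : ℤ) - 1)) = G ((t : ℤ) - 1) := by
        intro t
        induction t with
        | zero => rw [hG _ (by simp), hG' _ (by simp), map_zero]
        | succ t ih =>
          rw [hG'H, hGH, map_add, hf]
          have : ((t + 1 : ℕ) : ℤ) - 1 - 1 = (t : ℤ) - 1 := by push_cast; ring
          rw [this, ih]
      intro k
      by_cases h : k < 0
      · rw [hG _ h, hG' _ h, map_zero]
      · have := key (k + 1).toNat
        have h3 : (((k + 1).toNat : ℕ) : ℤ) - 1 = k := by omega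
        rwa [h3] at this
    have main := congrArg f (rect_dom (MvPolynomial ℤ ℤ) r c H' G' (by
      intro k h; simp [H', h]) hG' hG'H)
    rw [RingHom.map_det, map_sum] at main
    simp only [RingHom.map_det] at main
    convert main using 2
    · ext i j
      simp [hfG]
    · congr 1
      ext i j
      simp only [Matrix.of_apply, RingHom.mapMatrix_apply, Matrix.map_apply]
      split_ifs <;> simp [hf]

theorem hpoly_nat {R : Type} [CommRing R] {N : ℕ} (x : Fin N → R) (m : ℕ) :
    hpoly x (m : ℤ) =
      ∑ f ∈ Finset.univ.filter (fun f : Fin m → Fin N => Monotone f), ∏ i, x (f i) := by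
  rw [hpoly, if_pos (by simp)]
  rfl

theorem hpoly_neg {R : Type} [CommRing R] {N : ℕ} (x : Fin N → R) (k : ℤ) (hk : k < 0) :
    hpoly x k = 0 := by
  rw [hpoly, if_neg (by omega)]

theorem hpoly_zero {R : Type} [CommRing R] {N : ℕ} (x : Fin N → R) : hpoly x 0 = 1 := by
  have := hpoly_nat x 0
  rw [Nat.cast_zero] at this
  rw [this]
  have : (Finset.univ.filter (fun f : Fin 0 → Fin N => Monotone f)) = Finset.univ := by
    ext f
    simp only [Finset.mem_filter, Finset.mem_univ, true_and, iff_true]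
    exact fun i => i.elim0
  rw [this]
  simp

theorem hpoly_empty {R : Type} [CommRing R] (x : Fin 0 → R) (k : ℤ) :
    hpoly x k = if k = 0 then 1 else 0 := by
  rcases lt_trichotomy k 0 with h | h | h
  · rw [hpoly_neg _ _ h, if_neg (by omega)]
  · rw [h, hpoly_zero, if_pos rfl]
  · rw [if_neg (by omega)]
    obtain ⟨m, rfl⟩ : ∃ m : ℕ, k = ((m + 1 : ℕ) : ℤ) := ⟨k.toNat - 1, by omega⟩
    rw [hpoly_nat]
    apply Finset.sum_eq_zero
    intro f _
    exact (f 0).elim0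

theorem hpoly_succ_nat {R : Type} [CommRing R] {N : ℕ} (x : Fin (N + 1) → R) (m : ℕ) :
    hpoly x ((m + 1 : ℕ) : ℤ) = hpoly (fun i => x (Fin.castSucc i)) ((m + 1 : ℕ) : ℤ) +
      x (Fin.last N) * hpoly x (m : ℤ) := by
  rw [hpoly_nat, hpoly_nat, hpoly_nat, Finset.mul_sum,
    ← Finset.sum_filter_add_sum_filter_not _ (fun f => f (Fin.last m) ≠ Fin.last N)]
  congr 1
  · symm
    refine Finset.sum_bij (fun g _ => fun i => Fin.castSucc (g i)) ?_ ?_ ?_ ?_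
    · intro g hg
      simp only [Finset.mem_filter, Finset.mem_univ, true_and] at hg ⊢
      exact ⟨fun i j hij => Fin.castSucc_le_castSucc_iff.2 (hg hij), (Fin.castSucc_lt_last _).ne⟩
    · intro g _ g' _ h
      ext i
      have := congrFun h i
      simpa using congrArg Fin.val this
    · intro f hf
      simp only [Finset.mem_filter, Finset.mem_univ, true_and] at hf
      have hne : ∀ i, f i ≠ Fin.last N := by
        intro i h
        apply hf.2
        apply le_antisymm (Fin.le_last _)
        rw [← h]
        exact hf.1 (Fin.le_last _)
      refine ⟨fun i => (f i).castPred (hne i), ?_, ?_⟩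
      · simp only [Finset.mem_filter, Finset.mem_univ, true_and]
        intro i j hij
        exact Fin.castPred_le_castPred_iff.2 (hf.1 hij)
      · ext i; simp
    · intro g _
      rfl
  · refine Finset.sum_bij' (fun f _ => fun i => f (Fin.castSucc i))
      (fun g _ => Fin.snoc (α := fun _ => Fin (N + 1)) g (Fin.last N)) ?_ ?_ ?_ ?_ ?_
    · intro f hf
      simp only [Finset.mem_filter, Finset.mem_univ, true_and] at hf ⊢
      exact fun i j hij => hf.1 (Fin.castSucc_le_castSucc_iff.2 hij)
    · intro g hg
      simp only [Finset.mem_filter, Finset.mem_univ, true_and] at hg ⊢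
      refine ⟨?_, by simp⟩
      intro i j
      refine Fin.lastCases ?_ (fun j => ?_) j
      · intro _
        rw [Fin.snoc_last]
        exact Fin.le_last _
      · refine Fin.lastCases ?_ (fun i => ?_) i
        · intro h
          exact absurd h (not_le.2 (Fin.castSucc_lt_last j))
        · intro h
          rw [Fin.snoc_castSucc, Fin.snoc_castSucc]
          exact hg (Fin.castSucc_le_castSucc_iff.1 h)
    · intro f hf
      simp only [Finset.mem_filter, Finset.mem_univ, true_and, not_not] at hf
      ext i
      refine Fin.lastCases ?_ (fun j => ?_) i
      · rw [Fin.snoc_last, hf.2]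
      · rw [Fin.snoc_castSucc]
    · intro g _
      ext i
      simp
    · intro f hf
      simp only [Finset.mem_filter, Finset.mem_univ, true_and, not_not] at hf
      rw [Fin.prod_univ_castSucc, hf.2, mul_comm]

theorem hpoly_succ {R : Type} [CommRing R] {N : ℕ} (x : Fin (N + 1) → R) (k : ℤ) :
    hpoly x k = hpoly (fun i => x (Fin.castSucc i)) k + x (Fin.last N) * hpoly x (k - 1) := by
  rcases lt_trichotomy k 0 with h | h | h
  · rw [hpoly_neg _ _ h, hpoly_neg _ _ h, hpoly_neg _ _ (by omega)]; simp
  · rw [h, hpoly_zero, hpoly_zero, hpoly_neg _ _ (by omega)]; simp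
  · obtain ⟨m, rfl⟩ : ∃ m : ℕ, k = ((m + 1 : ℕ) : ℤ) := ⟨k.toNat - 1, by omega⟩
    rw [hpoly_succ_nat]
    have : ((m + 1 : ℕ) : ℤ) - 1 = m := by push_cast; ring
    rw [this]

theorem hpoly_xpm_odd {R : Type} [CommRing R] (n : ℕ) (x : Fin n → Rˣ) (k : ℤ) :
    hpoly (xpm n (2 * n + 1) x) k =
      hpoly (xpm n (2 * n) x) k + hpoly (xpm n (2 * n + 1) x) (k - 1) := by
  rw [hpoly_succ]
  have h1 : xpm n (2 * n + 1) x (Fin.last (2 * n)) = 1 := by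
    simp [xpm]
  rw [h1, one_mul]
  rfl

theorem hpoly_xpm_even {R : Type} [CommRing R] (n : ℕ) (x : Fin (n + 1) → Rˣ) (k : ℤ) :
    hpoly (xpm n (2 * n) (fun i => x (Fin.castSucc i))) k =
      hpoly (xpm (n + 1) (2 * (n + 1)) x) k
      - ((x (Fin.last n) : R) + ((x (Fin.last n))⁻¹ : Rˣ)) *
          hpoly (xpm (n + 1) (2 * (n + 1)) x) (k - 1)
      + hpoly (xpm (n + 1) (2 * (n + 1)) x) (k - 2) := by
  set y : Fin (2 * n + 1 + 1) → R := xpm (n + 1) (2 * n + 1 + 1) x with hy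
  have e0 : hpoly (xpm (n + 1) (2 * (n + 1)) x) = hpoly y := rfl
  have h1 : y (Fin.last (2 * n + 1)) = ((x (Fin.last n))⁻¹ : Rˣ) := by
    have e1 : (2 * n + 1) / 2 = n := by omega
    have e2 : (2 * n + 1) % 2 = 1 := by omega
    simp only [hy, xpm, Fin.val_last, e1, e2]
    rw [dif_pos (by omega)]
    rfl
  have h2 : y (Fin.castSucc (Fin.last (2 * n))) = (x (Fin.last n) : R) := by
    have e1 : (2 * n) / 2 = n := by omega
    have e2 : (2 * n) % 2 = 0 := by omega
    simp only [hy, xpm, Fin.val_last, Fin.val_castSucc, e1, e2]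
    rw [dif_pos (by omega)]
    rfl
  have h3 : (fun i : Fin (2 * n) => y (Fin.castSucc (Fin.castSucc i))) =
      xpm n (2 * n) (fun i => x (Fin.castSucc i)) := by
    ext i
    have e1 : (i : ℕ) / 2 < n := by omega
    have e2 : (i : ℕ) / 2 < n + 1 := by omega
    simp only [hy, xpm, Fin.val_castSucc]
    rw [dif_pos e1, dif_pos e2]
    rfl
  have r1 : ∀ k, hpoly (fun i => y (Fin.castSucc i)) k =
      hpoly y k - ((x (Fin.last n))⁻¹ : Rˣ) * hpoly y (k - 1) := by
    intro k
    rw [hpoly_succ y k, h1]; ring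
  have r2 : hpoly (xpm n (2 * n) (fun i => x (Fin.castSucc i))) k =
      hpoly (fun i => y (Fin.castSucc i)) k - x (Fin.last n) *
        hpoly (fun i => y (Fin.castSucc i)) (k - 1) := by
    rw [hpoly_succ (fun i => y (Fin.castSucc i)) k, h2, h3]; ring
  have hxx : (x (Fin.last n) : R) * ((x (Fin.last n))⁻¹ : Rˣ) = 1 := by simp
  rw [r2, r1, r1, e0]
  have : k - 1 - 1 = k - 2 := by ring
  rw [this]
  linear_combination hpoly y (k - 2) * hxx

/-- existence of the palindromic inverse series -/
theorem inv_even {R : Type} [CommRing R] (n : ℕ) (x : Fin n → Rˣ) :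
    ∃ p : PowerSeries R, ∃ b : ℤ → R, (∀ k, k < 0 → b k = 0) ∧
      (∀ k, b (2 * n - k) = b k) ∧ p = PowerSeries.mk (fun k : ℕ => b k) ∧
      PowerSeries.mk (fun k : ℕ => hpoly (xpm n (2 * n) x) k) * p = 1 := by
  induction n with
  | zero =>
    refine ⟨_, fun k => if k = 0 then 1 else 0, ?_, ?_, rfl, ?_⟩
    · intro k hk; simp; omega
    · intro k; simp
    · have h1 : (PowerSeries.mk fun k : ℕ => hpoly (xpm 0 (2 * 0) x) (k : ℤ)) = (1 : PowerSeries R) := by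
        ext m
        rw [PowerSeries.coeff_mk, PowerSeries.coeff_one]
        have := hpoly_empty (xpm 0 (2 * 0) x) (m : ℤ)
        rw [this]
        simp
      have h2 : (PowerSeries.mk fun k : ℕ => if (k : ℤ) = 0 then (1 : R) else 0) = 1 := by
        ext m
        rw [PowerSeries.coeff_mk, PowerSeries.coeff_one]
        simp
      rw [h1, h2, mul_one]
  | succ n ih =>
    obtain ⟨p, b, hb, hsym, hp, hmul⟩ := ih (fun i => x (Fin.castSucc i))
    set s : R := (x (Fin.last n) : R) + ((x (Fin.last n))⁻¹ : Rˣ) with hs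
    refine ⟨_, fun k => b k - s * b (k - 1) + b (k - 2), ?_, ?_, rfl, ?_⟩
    · intro k hk
      beta_reduce
      rw [hb k hk, hb _ (by omega), hb _ (by omega)]; simp
    · intro k
      have e1 : b (2 * ((n + 1 : ℕ) : ℤ) - k) = b (k - 2) := by
        rw [← hsym (k - 2)]; congr 1; push_cast; ring
      have e2 : b (2 * ((n + 1 : ℕ) : ℤ) - k - 1) = b (k - 1) := by
        rw [← hsym (k - 1)]; congr 1; push_cast; ring
      have e3 : b (2 * ((n + 1 : ℕ) : ℤ) - k - 2) = b k := by
        rw [← hsym k]; congr 1; push_cast; ring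
      beta_reduce
      rw [e1, e2, e3]; ring
    · have cf : ∀ (f : ℤ → R) (hf : ∀ k, k < 0 → f k = 0),
          PowerSeries.mk (fun k : ℕ => f k - s * f (k - 1) + f (k - 2)) =
          PowerSeries.mk (fun k : ℕ => f k) * (1 - PowerSeries.C s * PowerSeries.X + PowerSeries.X ^ 2) := by
        intro f hf
        ext m
        have a1 := coeff_X_pow_mul_mk f hf 1 m
        have a2 := coeff_X_pow_mul_mk f hf 2 m
        have : PowerSeries.mk (fun k : ℕ => f k) * (1 - PowerSeries.C s * PowerSeries.X + PowerSeries.X ^ 2)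
          = PowerSeries.mk (fun k : ℕ => f k) - PowerSeries.C s * (PowerSeries.X ^ 1 * PowerSeries.mk (fun k : ℕ => f k))
            + PowerSeries.X ^ 2 * PowerSeries.mk (fun k : ℕ => f k) := by ring
        rw [this, map_add, map_sub, PowerSeries.coeff_C_mul, a1, a2, PowerSeries.coeff_mk, PowerSeries.coeff_mk]
        simp
      rw [cf b hb, ← hp]
      have := cf (hpoly (xpm (n + 1) (2 * (n + 1)) x)) (fun k hk => hpoly_neg _ k hk)
      rw [mul_left_comm, mul_comm, ← this] 
      rw [← hmul]
      congr 1
      ext m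
      rw [PowerSeries.coeff_mk, PowerSeries.coeff_mk, hpoly_xpm_even]

theorem inv_odd {R : Type} [CommRing R] (n : ℕ) (x : Fin n → Rˣ) :
    ∃ a : ℤ → R, (∀ k, k < 0 → a k = 0) ∧
      (∀ k, a (2 * n + 1 - k) = - a k) ∧
      PowerSeries.mk (fun k : ℕ => hpoly (xpm n (2 * n + 1) x) k) *
        PowerSeries.mk (fun k : ℕ => a k) = 1 := by
  obtain ⟨p, b, hb, hsym, hp, hmul⟩ := inv_even n x
  refine ⟨fun k => b k - b (k - 1), ?_, ?_, ?_⟩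
  · intro k hk
    beta_reduce
    rw [hb k hk, hb _ (by omega)]; simp
  · intro k
    have e1 : b (2 * (n : ℤ) + 1 - k) = b (k - 1) := by
      rw [← hsym (k - 1)]; congr 1; ring
    have e2 : b (2 * (n : ℤ) + 1 - k - 1) = b k := by
      rw [← hsym k]; congr 1; ring
    simp only [e1, e2]; ring
  · have cf : ∀ (f : ℤ → R) (hf : ∀ k, k < 0 → f k = 0),
        PowerSeries.mk (fun k : ℕ => f k - f (k - 1)) =
        PowerSeries.mk (fun k : ℕ => f k) * (1 - PowerSeries.X) := by
      intro f hf
      ext m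
      have a1 := coeff_X_pow_mul_mk f hf 1 m
      have : PowerSeries.mk (fun k : ℕ => f k) * (1 - PowerSeries.X)
        = PowerSeries.mk (fun k : ℕ => f k) - (PowerSeries.X ^ 1 * PowerSeries.mk (fun k : ℕ => f k)) := by ring
      rw [this, map_sub, a1, PowerSeries.coeff_mk, PowerSeries.coeff_mk]
      simp
    rw [cf b hb, ← hp]
    have := cf (hpoly (xpm n (2 * n + 1) x)) (fun k hk => hpoly_neg _ k hk)
    rw [mul_left_comm, mul_comm, ← this, ← hmul]
    congr 1
    ext m
    rw [PowerSeries.coeff_mk, PowerSeries.coeff_mk, hpoly_xpm_odd]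
    ring

theorem finRotate_pow_val (m t : ℕ) (i : Fin (m + 1)) :
    (((finRotate (m + 1)) ^ t) i : ℕ) = ((i : ℕ) + t) % (m + 1) := by
  induction t with
  | zero => simp [Nat.mod_eq_of_lt i.2]
  | succ t ih =>
    rw [pow_succ', Equiv.Perm.mul_apply, finRotate_succ_apply, Fin.val_add, ih, Fin.val_one']
    rw [← Nat.add_mod]
    congr 1

theorem toeplitz_mul {R : Type} [CommRing R] (G a : ℤ → R) (hG : ∀ k, k < 0 → G k = 0)
    (ha : ∀ k, k < 0 → a k = 0)
    (hGa : PowerSeries.mk (fun k : ℕ => G k) * PowerSeries.mk (fun k : ℕ => a k) = 1) (m : ℕ) :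
    (Matrix.of fun i j : Fin m => G (((j : ℕ) : ℤ) - ((i : ℕ) : ℤ))) *
      (Matrix.of fun i j : Fin m => a (((j : ℕ) : ℤ) - ((i : ℕ) : ℤ))) = 1 := by
  ext i j
  rw [Matrix.mul_apply]
  simp only [Matrix.of_apply]
  rw [Fin.sum_univ_eq_sum_range (fun k : ℕ => G ((k : ℤ) - ((i : ℕ) : ℤ)) * a (((j : ℕ) : ℤ) - k))]
  by_cases hij : (j : ℕ) < i
  · rw [Matrix.one_apply_ne (by rintro rfl; omega)]
    apply Finset.sum_eq_zero
    intro k _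
    by_cases hk : k < (i : ℕ)
    · rw [hG _ (by omega), zero_mul]
    · rw [ha _ (by omega), mul_zero]
  · have hsub : Finset.Ico (i : ℕ) ((j : ℕ) + 1) ⊆ Finset.range m := by
      intro k hk
      rw [Finset.mem_Ico] at hk
      rw [Finset.mem_range]
      omega
    rw [← Finset.sum_subset hsub, Finset.sum_Ico_eq_sum_range]
    · have := congrArg (PowerSeries.coeff ((j : ℕ) - (i : ℕ))) hGa
      rw [PowerSeries.coeff_mul, PowerSeries.coeff_one,
        Finset.Nat.sum_antidiagonal_eq_sum_range_succ_mk] at this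
      have e : (j : ℕ) + 1 - (i : ℕ) = ((j : ℕ) - (i : ℕ)).succ := by omega
      rw [e]
      have h1 : (1 : Matrix (Fin m) (Fin m) R) i j = if (j : ℕ) - (i : ℕ) = 0 then 1 else 0 := by
        rw [Matrix.one_apply]
        congr 1
        rw [eq_iff_iff, Fin.ext_iff]
        omega
      rw [h1, ← this]
      refine Finset.sum_congr rfl fun k hk => ?_
      rw [Finset.mem_range] at hk
      simp only [PowerSeries.coeff_mk]
      congr 2 <;> omega
    · intro k _ hk
      rw [Finset.mem_Ico] at hk
      by_cases hk : k < (i : ℕ)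
      · rw [hG _ (by omega), zero_mul]
      · rw [ha _ (by omega), mul_zero]

theorem jacobi {R : Type} [CommRing R] (G a : ℤ → R) (hG : ∀ k, k < 0 → G k = 0)
    (hG0 : G 0 = 1) (ha : ∀ k, k < 0 → a k = 0)
    (hGa : PowerSeries.mk (fun k : ℕ => G k) * PowerSeries.mk (fun k : ℕ => a k) = 1) (r c : ℕ) :
    Matrix.det (Matrix.of fun i j : Fin r => G ((c : ℤ) - ((i : ℕ) : ℤ) + ((j : ℕ) : ℤ))) =
    (-1) ^ (r * c) *
    Matrix.det (Matrix.of fun i j : Fin c => a ((r : ℤ) - ((i : ℕ) : ℤ) + ((j : ℕ) : ℤ))) := by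
  rcases Nat.eq_zero_or_pos (r + c) with h0 | h0
  · obtain ⟨rfl, rfl⟩ : r = 0 ∧ c = 0 := by omega
    simp
  obtain ⟨m, hm⟩ : ∃ m, r + c = m + 1 := ⟨r + c - 1, by omega⟩
  let T : Matrix (Fin (m + 1)) (Fin (m + 1)) R :=
    Matrix.of fun i j => G (((j : ℕ) : ℤ) - ((i : ℕ) : ℤ))
  let T' : Matrix (Fin (m + 1)) (Fin (m + 1)) R :=
    Matrix.of fun i j => a (((j : ℕ) : ℤ) - ((i : ℕ) : ℤ))
  have hTT : T * T' = 1 := toeplitz_mul G a hG ha hGa (m + 1)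
  have hT : T.det = 1 := by
    rw [Matrix.det_of_upperTriangular]
    · simp [T, hG0]
    · intro i j hij
      have : (j : ℕ) < i := hij
      simp only [T, Matrix.of_apply]
      exact hG _ (by omega)
  let ρ : Fin r ⊕ Fin c ≃ Fin (m + 1) := finSumFinEquiv.trans (finCongr hm)
  let σ : Equiv.Perm (Fin (m + 1)) := (finRotate (m + 1)) ^ c
  have ρl : ∀ i : Fin r, (ρ (Sum.inl i) : ℕ) = i := fun i => by simp [ρ]
  have ρr : ∀ i : Fin c, (ρ (Sum.inr i) : ℕ) = r + i := fun i => by simp [ρ]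
  have κl : ∀ i : Fin r, (σ (ρ (Sum.inl i)) : ℕ) = c + i := fun i => by
    rw [finRotate_pow_val, ρl, Nat.mod_eq_of_lt] <;> omega
  have κr : ∀ i : Fin c, (σ (ρ (Sum.inr i)) : ℕ) = i := fun i => by
    rw [finRotate_pow_val, ρr, ← hm]
    have : r + (i : ℕ) + c = i + (r + c) := by ring
    rw [this, Nat.add_mod_right, Nat.mod_eq_of_lt]
    omega
  let κ : Fin r ⊕ Fin c ≃ Fin (m + 1) := ρ.trans σ
  have hMM : T.submatrix ρ κ * T'.submatrix κ ρ = 1 := by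
    rw [Matrix.submatrix_mul_equiv, hTT, Matrix.submatrix_one_equiv]
  have hsign : ((Equiv.Perm.sign σ : ℤ) : R) = (-1) ^ (r * c) := by
    simp only [σ, map_pow, sign_finRotate]
    push_cast
    rw [← pow_mul]
    obtain ⟨t, ht⟩ : ∃ t, m * c + r * c = 2 * t := by
      rcases c with _ | c
      · exact ⟨0, by simp⟩
      · have hm' : m = r + c := by omega
        obtain ⟨u, hu⟩ := Nat.even_mul_succ_self c
        exact ⟨r * (c + 1) + u, by rw [hm']; linarith [hu, Nat.succ_eq_add_one c]⟩
    have h3 : ((-1 : R)) ^ (m * c) * (-1) ^ (r * c) = 1 := by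
      rw [← pow_add, ht, pow_mul]; simp
    have h4 : ((-1 : R)) ^ (r * c) * (-1) ^ (r * c) = 1 := by
      rw [← pow_add, ← two_mul, pow_mul]; simp
    calc ((-1 : R)) ^ (m * c) = (-1) ^ (m * c) * ((-1) ^ (r * c) * (-1) ^ (r * c)) := by
          rw [h4, mul_one]
      _ = _ := by rw [← mul_assoc, h3, one_mul]
  have hM : (T.submatrix ρ κ).det = (-1) ^ (r * c) := by
    have : T.submatrix ρ κ = (T.submatrix id σ).submatrix ρ ρ := rfl
    rw [this, Matrix.det_submatrix_equiv_self, Matrix.det_permute', hT, mul_one, hsign]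
  set M := T.submatrix ρ κ with hMdef
  set M' := T'.submatrix κ ρ with hM'def
  have hA : M.toBlocks₁₁ = Matrix.of fun i j : Fin r =>
      G ((c : ℤ) - ((i : ℕ) : ℤ) + ((j : ℕ) : ℤ)) := by
    ext i j
    simp only [hMdef, Matrix.toBlocks₁₁, Matrix.of_apply, Matrix.submatrix_apply, T, κ,
      Equiv.trans_apply, κl, ρl]
    congr 1; push_cast; ring
  have hD : M'.toBlocks₂₂ = Matrix.of fun i j : Fin c =>
      a ((r : ℤ) - ((i : ℕ) : ℤ) + ((j : ℕ) : ℤ)) := by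
    ext i j
    simp only [hM'def, Matrix.toBlocks₂₂, Matrix.of_apply, Matrix.submatrix_apply, T', κ,
      Equiv.trans_apply, κr, ρr]
    congr 1; push_cast; ring
  rw [← hA, ← hD, ← hM]
  rw [← Matrix.fromBlocks_toBlocks M, ← Matrix.fromBlocks_toBlocks M', Matrix.fromBlocks_multiply,
    ← Matrix.fromBlocks_one, Matrix.fromBlocks_inj] at hMM
  have key : M * Matrix.fromBlocks 1 M'.toBlocks₁₂ 0 M'.toBlocks₂₂ =
      Matrix.fromBlocks M.toBlocks₁₁ 0 M.toBlocks₂₁ 1 := by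
    conv_lhs => rw [← Matrix.fromBlocks_toBlocks M]
    rw [Matrix.fromBlocks_multiply, hMM.2.1, hMM.2.2.2]
    simp
  have := congrArg Matrix.det key
  rw [Matrix.det_mul, Matrix.det_fromBlocks_zero₂₁, Matrix.det_fromBlocks_zero₁₂] at this
  simpa using this.symm

theorem duality {R : Type} [CommRing R] (n : ℕ) (x : Fin n → Rˣ) (r s c : ℕ)
    (hrs : r + s = 2 * n + 1) :
    schur (fun _ : Fin r => (c : ℤ)) (xpm n (2 * n + 1) x) =
      schur (fun _ : Fin s => (c : ℤ)) (xpm n (2 * n + 1) x) := by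
  obtain ⟨a, ha, hsym, hmul⟩ := inv_odd n x
  have J := jacobi (hpoly (xpm n (2 * n + 1) x)) a (fun k hk => hpoly_neg _ k hk)
    (hpoly_zero _) ha hmul
  rw [schur, schur, J r c, J s c]
  have h1 : (Matrix.of fun i j : Fin c => a ((r : ℤ) - ((i : ℕ) : ℤ) + ((j : ℕ) : ℤ))) =
      -(Matrix.of fun i j : Fin c => a ((s : ℤ) - ((i : ℕ) : ℤ) + ((j : ℕ) : ℤ))).transpose := by
    ext i j
    simp only [Matrix.of_apply, Matrix.neg_apply, Matrix.transpose_apply]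
    rw [← hsym]
    congr 1
    have : (s : ℤ) = 2 * n + 1 - r := by omega
    rw [this]
    ring
  rw [h1, Matrix.det_neg, Matrix.det_transpose, Fintype.card_fin, ← mul_assoc, ← pow_add]
  congr 1
  have h2 : r * c + c + s * c = 2 * ((n + 1) * c) := by
    have : s = 2 * n + 1 - r := by omega
    calc r * c + c + s * c = (r + s + 1) * c := by ring
      _ = _ := by rw [hrs]; ring
  have h3 : ((-1 : R)) ^ (r * c + c) * (-1) ^ (s * c) = 1 := by
    rw [← pow_add, h2, pow_mul]; simp
  have h4 : ((-1 : R)) ^ (s * c) * (-1) ^ (s * c) = 1 := by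
    rw [← pow_add, ← two_mul, pow_mul]; simp
  calc ((-1 : R)) ^ (r * c + c) = (-1) ^ (r * c + c) * ((-1) ^ (s * c) * (-1) ^ (s * c)) := by
        rw [h4, mul_one]
    _ = _ := by rw [← mul_assoc, h3, one_mul]

/-- `s_{2n+1}((c^r); x^{±1})` as a sum of symplectic characters
`sp_{2n}(ν; x^{±1})`. -/
theorem schurOdd_eq_sum_spCharEven
    (n c r : ℕ) (hr : 1 ≤ r) (hrn : r ≤ 2 * n + 1)
    (R : Type) [CommRing R] (x : Fin n → Rˣ) :
    (r ≤ n →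
      schur (fun _ : Fin r => (c : ℤ)) (xpm n (2 * n + 1) x)
        = ∑ ν ∈ ((Fintype.piFinset fun _ : Fin r => Finset.range (c + 1)).filter
              (fun ν => Antitone ν)),
            spChar (fun i => (ν i : ℤ)) (xpm n (2 * n) x)) ∧
    (n < r →
      schur (fun _ : Fin r => (c : ℤ)) (xpm n (2 * n + 1) x)
        = ∑ ν ∈ ((Fintype.piFinset fun _ : Fin (2 * n + 1 - r) => Finset.range (c + 1)).filter
              (fun ν => Antitone ν)),
            spChar (fun i => (ν i : ℤ)) (xpm n (2 * n) x)) := by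
  have main : ∀ s : ℕ, schur (fun _ : Fin s => (c : ℤ)) (xpm n (2 * n + 1) x)
        = ∑ ν ∈ ((Fintype.piFinset fun _ : Fin s => Finset.range (c + 1)).filter
              (fun ν => Antitone ν)),
            spChar (fun i => (ν i : ℤ)) (xpm n (2 * n) x) := fun s =>
    rect_general R s c (hpoly (xpm n (2 * n) x)) (hpoly (xpm n (2 * n + 1) x))
      (fun k hk => hpoly_neg _ k hk) (fun k hk => hpoly_neg _ k hk) (hpoly_xpm_odd n x)
  refine ⟨fun _ => main r, fun _ => ?_⟩
  rw [duality n x r (2 * n + 1 - r) c (by omega)]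
  exact main _

end
end

section
/- Let N ≥ 2 and let r, c, p be nonnegative integers with c ≥ 1 and p ≤ r ≤ ⌊N/2⌋. Then s_N((c^{r−p},(c−1)^p); x^{±1}) = Σ_{ν ⊆ (c^r), oddrows((c^r)/ν)=p} o_N(ν; x^{±1}), an identity of Laurent polynomials in x_1,…,x_n, where N = 2n or N = 2n+1. -/
open scoped Classical
open Finset

noncomputable section

/-- The formal orthogonal character `o(λ; x)`. -/
def oChar {R : Type} [CommRing R] {N r : ℕ} (lam : Fin r → ℤ) (x : Fin N → R) : R :=
  Matrix.det (Matrix.of fun i j : Fin r =>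
    hpoly x (lam i - ((i : ℕ) : ℤ) + ((j : ℕ) : ℤ)) -
      hpoly x (lam i - ((i : ℕ) : ℤ) - ((j : ℕ) : ℤ) - 2))

/-- The number of odd rows of the skew shape `(C^n)/ν`. -/
def oddRowsCount {n : ℕ} (C : ℕ) (ν : Fin n → ℕ) : ℕ :=
  (Finset.univ.filter (fun i : Fin n => Odd ((C : ℤ) - (ν i : ℤ)))).card


/-- The product `∏_{i ≤ j} (1 - y_i y_j)`, as a product over unordered pairs. -/
def Kp {B : Type} [CommRing B] {r : ℕ} (y : Fin r → B) : B :=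
  ∏ z : Sym2 (Fin r), (1 - (z.map y).mul)

lemma Kp_comp_perm {B : Type} [CommRing B] {r : ℕ} (y : Fin r → B) (σ : Equiv.Perm (Fin r)) :
    Kp (fun i => y (σ i)) = Kp y := by
  unfold Kp
  refine Fintype.prod_bijective (Sym2.map σ) ?_ _ _ ?_
  · exact ⟨Sym2.map.injective σ.injective, fun z => ⟨z.map σ.symm, by
      rw [Sym2.map_map]; simp⟩⟩
  · intro z
    rw [Sym2.map_map]; rfl

lemma map_Kp {B B' : Type} [CommRing B] [CommRing B'] (φ : B →+* B') {r : ℕ} (y : Fin r → B) :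
    φ (Kp y) = Kp (fun i => φ (y i)) := by
  unfold Kp
  rw [map_prod]
  refine Finset.prod_congr rfl fun z _ => ?_
  induction z with | _ a b => simp

lemma Kp_succAbove {B : Type} [CommRing B] {r : ℕ} (y : Fin (r+1) → B) (i : Fin (r+1)) :
    Kp y = (∏ j, (1 - y i * y j)) * Kp (fun j => y (i.succAbove j)) := by
  unfold Kp
  rw [← Finset.sym2_univ, Fin.univ_succAbove r i, Finset.sym2_cons, Finset.prod_disjUnion,
    Finset.prod_map, Finset.sym2_map, Finset.prod_map, Finset.sym2_univ]
  congr 1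
  refine Finset.prod_congr rfl fun z _ => ?_
  induction z with | _ a b => simp

lemma det_cofactor {B : Type} [CommRing B] {r : ℕ} (y : Fin (r+1) → B) (u : Fin (r+1) → B)
    (E : Fin r → ℕ) :
    (Matrix.of fun i (j : Fin (r+1)) => (Fin.cases (u i) (fun j' => y i ^ (E j' + 1)) j : B)).det
    = ∑ i : Fin (r+1), (-1) ^ (i : ℕ) * u i * ((∏ j, y (i.succAbove j)) *
        (Matrix.of fun a j => y (i.succAbove a) ^ (E j)).det) := by
  rw [Matrix.det_succ_column_zero]
  refine Finset.sum_congr rfl fun i _ => ?_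
  rw [← Matrix.det_mul_column]
  congr 2
  ext a j
  simp [pow_succ']

lemma det_lagrange {B : Type} [CommRing B] {r : ℕ} (y : Fin (r+1) → B) :
    (Matrix.of fun i (j : Fin (r+1)) =>
      (Fin.cases (∏ k, (1 - y i * y k)) (fun j' => y i ^ ((j' : ℕ) + 1)) j : B)).det
    = (1 - (∏ i, y i)^2) * (Matrix.vandermonde y).det := by
  set V := Matrix.vandermonde y
  let p : Polynomial B := ∏ k, (1 + Polynomial.C (- y k) * Polynomial.X)
  have hdeg1 : ∀ k ∈ (univ : Finset (Fin (r+1))),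
      (1 + Polynomial.C (- y k) * Polynomial.X : Polynomial B).natDegree ≤ 1 := by
    intro k _
    compute_degree
  have hdeg : p.natDegree < r + 2 := by
    refine Nat.lt_succ_of_le ((Polynomial.natDegree_prod_le _ _).trans ?_)
    refine (Finset.sum_le_sum hdeg1).trans ?_
    simp
  have h0 : p.coeff 0 = 1 := by
    rw [Polynomial.coeff_zero_eq_eval_zero, Polynomial.eval_prod]
    simp
  have htop : p.coeff (r+1) = (-1)^(r+1) * ∏ i, y i := by
    have := Polynomial.coeff_prod_of_natDegree_le univ _ 1 hdeg1
    rw [Finset.card_univ, Fintype.card_fin, mul_one] at this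
    rw [this]
    simp only [Polynomial.coeff_add, Polynomial.coeff_C_mul_X]
    simp [Polynomial.coeff_one, Finset.prod_neg]
  have hev : ∀ x, ∏ k, (1 - x * y k) = ∑ k ∈ range (r+2), p.coeff k * x ^ k := by
    intro x
    rw [← Polynomial.eval_eq_sum_range' hdeg, Polynomial.eval_prod]
    refine Finset.prod_congr rfl fun k _ => ?_
    simp; ring
  have hM : (Matrix.of fun i (j : Fin (r+1)) =>
      (Fin.cases (∏ k, (1 - y i * y k)) (fun j' => y i ^ ((j' : ℕ) + 1)) j : B))
      = V.updateCol 0 ((fun i => ∑ k : Fin (r+1), p.coeff k • V i k)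
        + p.coeff (r+1) • fun i => y i ^ (r+1)) := by
    ext i j
    refine Fin.cases ?_ (fun j' => ?_) j
    · simp only [Matrix.of_apply, Fin.cases_zero, Matrix.updateCol_self, Pi.add_apply,
        Pi.smul_apply, smul_eq_mul]
      rw [hev, Finset.sum_range_succ, Finset.sum_range]
      simp [V, Matrix.vandermonde_apply]
    · rw [Matrix.updateCol_ne (Fin.succ_ne_zero _)]
      simp [V, Matrix.vandermonde_apply]
  have hrot : (V.updateCol 0 (fun i => y i ^ (r+1))).det = (-1)^r * ((∏ i, y i) * V.det) := by
    have h1 := Matrix.det_permute' (finRotate (r+1)).symm V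
    rw [Equiv.Perm.sign_symm, sign_finRotate] at h1
    have h2 := Matrix.det_mul_column y (V.submatrix id (finRotate (r+1)).symm)
    rw [h1] at h2
    have h3 : (V.updateCol 0 (fun i => y i ^ (r+1)))
        = Matrix.of fun i j => y i * (V.submatrix id (finRotate (r+1)).symm) i j := by
      ext i j
      refine Fin.cases ?_ (fun j' => ?_) j
      · have : (finRotate (r+1)).symm 0 = Fin.last r := by
          rw [Equiv.symm_apply_eq]; simp
        simp only [Matrix.updateCol_self, Matrix.of_apply, Matrix.submatrix_apply, this]
        simp [V, Matrix.vandermonde_apply, pow_succ']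
      · rw [Matrix.updateCol_ne (Fin.succ_ne_zero _)]
        have : (finRotate (r+1)).symm j'.succ = j'.castSucc := by
          rw [Equiv.symm_apply_eq]; simp
        simp only [Matrix.of_apply, Matrix.submatrix_apply, this]
        simp [V, Matrix.vandermonde_apply, pow_succ']
    rw [h3, h2]
    push_cast
    ring
  rw [hM, Matrix.det_updateCol_add, Matrix.det_updateCol_sum V 0 (fun k => p.coeff k),
    Matrix.det_updateCol_smul, hrot, htop]
  simp only [Fin.val_zero, h0, smul_eq_mul]
  have : ((-1 : B)^r)^2 = 1 := by rw [← pow_mul, mul_comm, pow_mul]; simp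
  linear_combination (-(∏ i, y i)^2 * V.det) * this

/-- Partial sums. -/
def pre {r : ℕ} (m : Fin r → ℕ) (j : Fin r) : ℕ := ∑ k ∈ univ.filter (fun k => k ≤ j), m k

lemma pre_zero {r : ℕ} (m : Fin (r+1) → ℕ) : pre m 0 = m 0 := by
  unfold pre
  rw [Finset.sum_filter, Fin.sum_univ_succ]
  simp

lemma pre_succ {r : ℕ} (m : Fin (r+1) → ℕ) (j : Fin r) :
    pre m j.succ = m 0 + pre (fun k => m k.succ) j := by
  unfold pre
  rw [Finset.sum_filter, Fin.sum_univ_succ, Finset.sum_filter]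
  simp

lemma pre_inj {r : ℕ} : ∀ (m m' : Fin r → ℕ), pre m = pre m' → m = m' := by
  induction r with
  | zero => intro m m' _; exact Subsingleton.elim _ _
  | succ r ih =>
    intro m m' h
    have h0 : m 0 = m' 0 := by rw [← pre_zero m, ← pre_zero m', h]
    have := ih (fun k => m k.succ) (fun k => m' k.succ) (by
      ext j
      have := congrFun h j.succ
      rw [pre_succ, pre_succ] at this
      omega)
    ext k
    refine Fin.cases h0 (fun j => congrFun this j) k

lemma pre_mono {r : ℕ} (m : Fin r → ℕ) : Monotone (pre m) := by
  intro i j hij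
  unfold pre
  refine Finset.sum_le_sum_of_subset ?_
  intro k
  simp
  intro h; exact h.trans hij

lemma pre_surj {r : ℕ} : ∀ (s : Fin r → ℕ), Monotone s → ∃ m, pre m = s ∧ ∀ k, m k ≤ s k := by
  induction r with
  | zero => intro s _; exact ⟨s, Subsingleton.elim _ _, fun k => k.elim0⟩
  | succ r ih =>
    intro s hs
    obtain ⟨m, hm, hle⟩ := ih (fun k => s k.succ - s 0) (fun i j hij =>
      Nat.sub_le_sub_right (hs (by simpa using hij)) _)
    refine ⟨Fin.cons (s 0) m, ?_, ?_⟩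
    · ext k
      refine Fin.cases ?_ (fun j => ?_) k
      · rw [pre_zero]; rfl
      · rw [pre_succ]
        simp only [Fin.cons_zero, Fin.cons_succ]
        rw [hm]
        have : s 0 ≤ s j.succ := hs (Fin.zero_le _)
        simp only
        omega
    · intro k
      refine Fin.cases ?_ (fun j => ?_) k
      · simp
      · simp only [Fin.cons_succ]
        exact (hle j).trans (Nat.sub_le _ _)

lemma littlewood {B : Type} [CommRing B] (M : ℕ) : ∀ {r : ℕ} (y : Fin r → B),
    (∀ i, y i ^ M = 0) →
    (∑ m : Fin r → Fin M, (Matrix.of fun i j : Fin r =>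
      y i ^ (2 * pre (fun k => (m k : ℕ)) j + (j : ℕ))).det) * Kp y
      = (Matrix.vandermonde y).det := by
  intro r
  induction r with
  | zero => 
    intro y _
    simp [Kp]
  | succ r ih =>
    intro y hy
    set Y := ∏ i, y i with hY
    have hgeom : (1 - Y^2) * ∑ a : Fin M, (Y^2)^(a:ℕ) = 1 := by
      rw [← Finset.sum_range (fun a => (Y^2)^a), mul_neg_geom_sum, ← pow_mul, hY,
        ← Finset.prod_pow, Fin.prod_univ_succ, mul_comm 2 M, pow_mul, hy]
      simp
    have hF : (∑ m : Fin (r+1) → Fin M, (Matrix.of fun i j : Fin (r+1) =>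
        y i ^ (2 * pre (fun k => (m k : ℕ)) j + (j : ℕ))).det)
        = (∑ a : Fin M, (Y^2)^(a:ℕ)) * ∑ m : Fin r → Fin M,
          ∑ i : Fin (r+1), (-1) ^ (i : ℕ) * 1 * ((∏ j, y (i.succAbove j)) *
        (Matrix.of fun a j => y (i.succAbove a) ^ (2 * pre (fun k => (m k : ℕ)) j + (j : ℕ))).det) := by
      rw [← (Fin.consEquiv (fun _ => Fin M)).sum_comp, Fintype.sum_prod_type, Finset.sum_mul]
      refine Finset.sum_congr rfl fun a _ => ?_
      rw [Finset.mul_sum]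
      refine Finset.sum_congr rfl fun m _ => ?_
      rw [← det_cofactor y (fun _ => 1), hY, ← Finset.prod_pow, ← Finset.prod_pow,
        ← Matrix.det_mul_column]
      congr 2
      ext i j
      refine Fin.cases ?_ (fun j' => ?_) j
      · simp [pre_zero, Fin.consEquiv, pow_mul]
      · simp only [pre_succ, Fin.consEquiv, Equiv.coe_fn_mk, Fin.cons_zero, Fin.cons_succ,
          Fin.val_succ, Fin.cases_succ, Matrix.of_apply]
        ring
    have hL := det_lagrange y
    rw [det_cofactor y (fun i => ∏ k, (1 - y i * y k)) (fun j => (j:ℕ))] at hL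
    have hG : (∑ m : Fin r → Fin M,
          ∑ i : Fin (r+1), (-1) ^ (i : ℕ) * 1 * ((∏ j, y (i.succAbove j)) *
        (Matrix.of fun a j => y (i.succAbove a) ^ (2 * pre (fun k => (m k : ℕ)) j + (j : ℕ))).det))
        * Kp y = (1 - Y^2) * (Matrix.vandermonde y).det := by
      rw [← hL, Finset.sum_comm, Finset.sum_mul]
      refine Finset.sum_congr rfl fun i _ => ?_
      have := ih (fun j => y (i.succAbove j)) (fun j => hy _)
      rw [← Finset.mul_sum, ← Finset.mul_sum, Kp_succAbove y i]
      have h2 : (Matrix.of fun a j : Fin r => y (i.succAbove a) ^ (j:ℕ)).det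
        = (Matrix.vandermonde fun j => y (i.succAbove j)).det := rfl
      rw [h2, ← this]
      ring
    rw [hF, mul_assoc, hG]
    linear_combination (Matrix.vandermonde y).det * hgeom

lemma cheb {B : Type} [CommRing B] (j : ℕ) : ∃ t : ℕ → B, t j = 1 ∧ (∀ k, j < k → t k = 0) ∧
    ∀ y : B, ∑ k ∈ range (j+1), y^(2*k) = ∑ k ∈ range (j+1), t k * (1+y^2)^k * y^(j-k) := by
  induction j using Nat.twoStepInduction with
  | zero =>
    refine ⟨fun k => if k = 0 then 1 else 0, by simp, fun k hk => by simp; omega, fun y => by simp⟩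
  | one =>
    refine ⟨fun k => if k = 1 then 1 else 0, by simp, fun k hk => by simp; omega, fun y => by
      simp [Finset.sum_range_succ]⟩
  | more j ih0 ih1 =>
    obtain ⟨t0, h01, h02, h03⟩ := ih0
    obtain ⟨t1, h11, h12, h13⟩ := ih1
    refine ⟨fun k => (if k = 0 then 0 else t1 (k-1)) - t0 k, ?_, ?_, ?_⟩
    · simp only [Nat.add_eq_zero_iff]
      rw [if_neg (by omega), h02 _ (by omega), show j + 2 - 1 = j + 1 by omega, h11, sub_zero]
    · intro k hk
      simp only
      rw [if_neg (by omega), h02 _ (by omega), h12 _ (by omega), sub_zero]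
    · intro y
      have e1 : ∑ k ∈ range (j+2+1), ((if k = 0 then 0 else t1 (k-1)) - t0 k) * (1+y^2)^k * y^(j+2-k)
          = ∑ k ∈ range (j+2+1), (if k = 0 then 0 else t1 (k-1)) * (1+y^2)^k * y^(j+2-k)
            - ∑ k ∈ range (j+2+1), t0 k * (1+y^2)^k * y^(j+2-k) := by
        rw [← Finset.sum_sub_distrib]
        refine Finset.sum_congr rfl fun k _ => by ring
      have e2 : ∑ k ∈ range (j+2+1), (if k = 0 then 0 else t1 (k-1)) * (1+y^2)^k * y^(j+2-k)
          = (1 + y^2) * ∑ k ∈ range (j+1+1), y^(2*k) := by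
        rw [h13, Finset.sum_range_succ', Finset.mul_sum]
        simp only [Nat.add_eq_zero_iff, one_ne_zero, and_false, if_false, if_true, zero_mul,
          add_zero, Nat.add_sub_cancel]
        refine Finset.sum_congr rfl fun k hk => ?_
        rw [show j + 2 - (k+1) = j + 1 - k by omega]
        ring
      have e3 : ∑ k ∈ range (j+2+1), t0 k * (1+y^2)^k * y^(j+2-k)
          = y^2 * ∑ k ∈ range (j+1), y^(2*k) := by
        rw [h03, Finset.sum_range_succ, Finset.sum_range_succ, h02 (j+2) (by omega),
          h02 (j+1) (by omega), Finset.mul_sum]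
        simp only [zero_mul, add_zero]
        refine Finset.sum_congr rfl fun k hk => ?_
        have : k < j + 1 := Finset.mem_range.1 hk
        rw [show j + 2 - k = j - k + 2 by omega]
        ring
      rw [e1, e2, e3, Finset.sum_range_succ _ (j+2), Finset.sum_range_succ _ (j+1)]
      ring

lemma Kp_eq_prod {B : Type} [CommRing B] {r : ℕ} (y : Fin r → B) :
    (∏ i, (1 - y i ^ 2)) * ∏ i, ∏ j ∈ Ioi i, (1 - y i * y j) = Kp y := by
  induction r with
  | zero => simp [Kp]
  | succ r ih =>
    rw [Kp_succAbove y 0]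
    simp only [Fin.zero_succAbove]
    rw [← ih (fun j => y j.succ)]
    simp only [Fin.prod_univ_succ, Fin.prod_Ioi_zero, Fin.prod_Ioi_succ]
    ring

lemma weylC {B : Type} [CommRing B] {r : ℕ} (y : Fin r → B) :
    (Matrix.of fun i j : Fin r => y i ^ (j.rev : ℕ) - y i ^ (r + 1 + (j : ℕ))).det
    = (Matrix.of fun i j : Fin r => y i ^ (j.rev : ℕ)).det * Kp y := by
  choose t ht1 ht2 ht3 using (cheb (B := B))
  let T : Matrix (Fin r) (Fin r) B := Matrix.of fun k j => t j k
  have hT : T.det = 1 := by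
    rw [Matrix.det_of_isUpperTriangular]
    · exact Finset.prod_eq_one fun i _ => ht1 _
    · intro i j hij
      exact ht2 _ _ hij
  have h1 : (Matrix.of fun i j : Fin r => y i ^ (j.rev : ℕ) - y i ^ (r + 1 + (j : ℕ)))
      = Matrix.of fun i j => (1 - y i ^ 2) *
        (Matrix.projVandermonde (fun i => 1 + y i ^ 2) y * T) i j := by
    ext i j
    have hq : (Matrix.projVandermonde (fun i => 1 + y i ^ 2) y * T) i j
        = y i ^ (j.rev : ℕ) * ∑ k ∈ range ((j:ℕ)+1), (y i)^(2*k) := by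
      rw [ht3, Matrix.mul_apply, Finset.mul_sum]
      simp only [Matrix.projVandermonde_apply, T, Matrix.of_apply]
      rw [Finset.sum_subset (s₂ := range r)
        (f := fun k => y i ^ (j.rev : ℕ) * (t j k * (1 + y i ^ 2)^k * y i ^ ((j:ℕ) - k)))
        (by intro k; simp; omega)
        (by intro k _ hk; rw [ht2 _ _ (by simpa using hk)]; simp),
        Finset.sum_range]
      refine Finset.sum_congr rfl fun k _ => ?_
      by_cases hk : (k:ℕ) ≤ j
      · have : (k.rev : ℕ) = j.rev + (j - k) := by
          simp only [Fin.val_rev]; omega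
        rw [this]; ring
      · rw [ht2 _ _ (by omega)]; simp
    simp only [Matrix.of_apply]
    rw [hq]
    have hg := mul_neg_geom_sum (y i ^ 2) ((j:ℕ)+1)
    simp only [← pow_mul] at hg
    have : r + 1 + (j:ℕ) = j.rev + 2 * ((j:ℕ)+1) := by
      simp only [Fin.val_rev]; omega
    rw [this]
    linear_combination (-(y i ^ (j.rev : ℕ))) * hg
  have h2 : (Matrix.of fun i j : Fin r => y i ^ (j.rev : ℕ))
      = Matrix.projVandermonde (fun _ => 1) y := by
    ext i j; simp [Matrix.projVandermonde_apply]
  rw [h1, Matrix.det_mul_column, Matrix.det_mul, hT, h2, Matrix.det_projVandermonde,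
    Matrix.det_projVandermonde, ← Kp_eq_prod, mul_one, mul_left_comm]
  congr 1
  rw [← Finset.prod_mul_distrib]
  refine Finset.prod_congr rfl fun i _ => ?_
  rw [← Finset.prod_mul_distrib]
  refine Finset.prod_congr rfl fun j _ => ?_
  ring

/-- The linear functional sending the monomial `y^b` to `∏ h (A - b_i)`. -/
def Lam {R : Type} [CommRing R] (h : ℤ → R) (A : ℤ) (r : ℕ) : MvPolynomial (Fin r) R →ₗ[R] R :=
  (MvPolynomial.basisMonomials (Fin r) R).constr R (fun b => ∏ i, h (A - (b i : ℤ)))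

lemma Lam_monomial {R : Type} [CommRing R] (h : ℤ → R) (A : ℤ) {r : ℕ} (b : Fin r →₀ ℕ) :
    Lam h A r (MvPolynomial.monomial b 1) = ∏ i, h (A - (b i : ℤ)) := by
  have := (MvPolynomial.basisMonomials (Fin r) R).constr_basis R
    (fun b => ∏ i, h (A - (b i : ℤ))) b
  rw [MvPolynomial.coe_basisMonomials] at this
  exact this

lemma Lam_prod_X {R : Type} [CommRing R] (h : ℤ → R) (A : ℤ) {r : ℕ} (e : Fin r → ℕ) :
    Lam h A r (∏ i, MvPolynomial.X i ^ e i) = ∏ i, h (A - (e i : ℤ)) := by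
  have : (∏ i, MvPolynomial.X i ^ e i : MvPolynomial (Fin r) R)
      = MvPolynomial.monomial (Finsupp.equivFunOnFinite.symm e) 1 := by
    rw [MvPolynomial.monomial_eq, Finsupp.prod_fintype _ _ (by simp)]
    simp
  rw [this, Lam_monomial]
  simp

lemma Lam_rename {R : Type} [CommRing R] (h : ℤ → R) (A : ℤ) {r : ℕ} (σ : Equiv.Perm (Fin r))
    (f : MvPolynomial (Fin r) R) : Lam h A r (MvPolynomial.rename σ f) = Lam h A r f := by
  have : (Lam h A r) ∘ₗ (MvPolynomial.rename σ).toLinearMap = Lam h A r := by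
    refine (MvPolynomial.basisMonomials (Fin r) R).ext fun b => ?_
    rw [MvPolynomial.coe_basisMonomials]
    simp only [LinearMap.comp_apply, AlgHom.toLinearMap_apply, MvPolynomial.rename_monomial,
      Lam_monomial]
    rw [← Equiv.prod_comp σ]
    simp [Finsupp.mapDomain_apply σ.injective]
  exact LinearMap.congr_fun this f

lemma Lam_mul_pow {R : Type} [CommRing R] (h : ℤ → R) (hneg : ∀ m < 0, h m = 0) (A : ℤ) {r : ℕ}
    (M : ℕ) (hM : A < M) (i : Fin r) (f : MvPolynomial (Fin r) R) :
    Lam h A r (f * MvPolynomial.X i ^ M) = 0 := by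
  have : (Lam h A r) ∘ₗ (LinearMap.mulRight R (MvPolynomial.X i ^ M)) = 0 := by
    refine (MvPolynomial.basisMonomials (Fin r) R).ext fun b => ?_
    rw [MvPolynomial.coe_basisMonomials]
    simp only [LinearMap.comp_apply, LinearMap.mulRight_apply, LinearMap.zero_apply]
    rw [MvPolynomial.X_pow_eq_monomial, MvPolynomial.monomial_mul, one_mul, Lam_monomial]
    refine Finset.prod_eq_zero (Finset.mem_univ i) (hneg _ ?_)
    simp
    omega
  exact LinearMap.congr_fun this f

lemma Lam_ideal {R : Type} [CommRing R] (h : ℤ → R) (hneg : ∀ m < 0, h m = 0) (A : ℤ) {r : ℕ}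
    (M : ℕ) (hM : A < M) (f : MvPolynomial (Fin r) R)
    (hf : f ∈ Ideal.span (Set.range fun i : Fin r => (MvPolynomial.X i ^ M : MvPolynomial (Fin r) R))) :
    Lam h A r f = 0 := by
  obtain ⟨c, rfl⟩ := Ideal.mem_span_range_iff_exists_fun.1 hf
  rw [map_sum]
  exact Finset.sum_eq_zero fun i _ => Lam_mul_pow h hneg A M hM i _

lemma Lam_prod_sub {R : Type} [CommRing R] (h : ℤ → R) (A : ℤ) {r : ℕ} (a b : Fin r → ℕ) :
    Lam h A r (∏ i, (MvPolynomial.X i ^ a i - MvPolynomial.X i ^ b i))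
      = ∏ i, (h (A - (a i : ℤ)) - h (A - (b i : ℤ))) := by
  let E : Fin r → Bool → ℕ := fun i β => bif β then a i else b i
  let s : Bool → R := fun β => bif β then 1 else -1
  have h1 : ∀ i : Fin r, (MvPolynomial.X i ^ a i - MvPolynomial.X i ^ b i : MvPolynomial (Fin r) R)
      = ∑ β : Bool, MvPolynomial.C (s β) * MvPolynomial.X i ^ E i β := by
    intro i; simp [s, E]; ring
  have h2 : ∀ i : Fin r, h (A - (a i : ℤ)) - h (A - (b i : ℤ))
      = ∑ β : Bool, s β * h (A - (E i β : ℤ)) := by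
    intro i; simp [s, E]; ring
  simp only [h1, h2]
  rw [Finset.prod_univ_sum, Finset.prod_univ_sum, map_sum]
  refine Finset.sum_congr rfl fun x _ => ?_
  rw [Finset.prod_mul_distrib, Finset.prod_mul_distrib, ← map_prod, ← MvPolynomial.smul_eq_C_mul,
    map_smul, Lam_prod_X, smul_eq_mul]

/-- Schur-type determinant indexed by exponents. -/
def Sdet {R : Type} [CommRing R] (h : ℤ → R) (c : ℕ) {r : ℕ} (e : Fin r → ℕ) : R :=
  (Matrix.of fun i j : Fin r => h ((c : ℤ) - (e i : ℤ) + ((j : ℕ) : ℤ))).det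

/-- Orthogonal-type determinant indexed by exponents. -/
def Odet {R : Type} [CommRing R] (h : ℤ → R) (c : ℕ) {r : ℕ} (e : Fin r → ℕ) : R :=
  (Matrix.of fun i j : Fin r => h ((c : ℤ) - (e i : ℤ) + ((j : ℕ) : ℤ))
    - h ((c : ℤ) - (e i : ℤ) - ((j : ℕ) : ℤ) - 2)).det

/-- The Vandermonde determinant in decreasing order. -/
def Dl (R : Type) [CommRing R] (r : ℕ) : MvPolynomial (Fin r) R :=
  (Matrix.of fun i j : Fin r => (MvPolynomial.X i : MvPolynomial (Fin r) R) ^ (j.rev : ℕ)).det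

/-- Monomials. -/
def mono (R : Type) [CommRing R] {r : ℕ} (e : Fin r → ℕ) : MvPolynomial (Fin r) R :=
  ∏ i, MvPolynomial.X i ^ e i

lemma Lam_S {R : Type} [CommRing R] (h : ℤ → R) (c : ℕ) {r : ℕ} (e : Fin r → ℕ) :
    Lam h ((c:ℤ) + r - 1) r (mono R e * Dl R r) = Sdet h c e := by
  unfold mono Dl Sdet
  rw [← Matrix.det_mul_column, ← Matrix.det_transpose, Matrix.det_apply, map_sum,
    ← Matrix.det_transpose, Matrix.det_apply]
  refine Finset.sum_congr rfl fun σ _ => ?_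
  rw [Units.smul_def, Units.smul_def, map_zsmul]
  congr 1
  simp only [Matrix.transpose_apply, Matrix.of_apply, ← pow_add]
  rw [Lam_prod_X]
  refine Finset.prod_congr rfl fun i _ => ?_
  congr 1
  have := (σ i).isLt
  simp only [Fin.val_rev]
  push_cast [Nat.cast_sub (show (σ i : ℕ) + 1 ≤ r from this)]
  ring

lemma Lam_O {R : Type} [CommRing R] (h : ℤ → R) (c : ℕ) {r : ℕ} (e : Fin r → ℕ) :
    Lam h ((c:ℤ) + r - 1) r (mono R e * (Dl R r * Kp MvPolynomial.X)) = Odet h c e := by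
  unfold mono Dl Odet
  rw [← weylC, ← Matrix.det_mul_column, ← Matrix.det_transpose, Matrix.det_apply, map_sum,
    ← Matrix.det_transpose, Matrix.det_apply]
  refine Finset.sum_congr rfl fun σ _ => ?_
  rw [Units.smul_def, Units.smul_def, map_zsmul]
  congr 1
  simp only [Matrix.transpose_apply, Matrix.of_apply, mul_sub, ← pow_add]
  rw [Lam_prod_sub]
  refine Finset.prod_congr rfl fun i _ => ?_
  have := (σ i).isLt
  simp only [Fin.val_rev]
  push_cast [Nat.cast_sub (show (σ i : ℕ) + 1 ≤ r from this)]
  congr 2 <;> ring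

lemma Lam_swap {R : Type} [CommRing R] (h : ℤ → R) (A : ℤ) {r : ℕ} (e : Fin r → ℕ)
    (Q : MvPolynomial (Fin r) R) (hQ : ∀ σ : Equiv.Perm (Fin r), MvPolynomial.rename σ Q = Q) :
    Lam h A r (mono R e * (Dl R r * Q))
    = Lam h A r ((Matrix.of fun i j : Fin r =>
        (MvPolynomial.X i : MvPolynomial (Fin r) R) ^ e j).det * (mono R (fun j => (j.rev : ℕ)) * Q)) := by
  unfold Dl
  rw [← Matrix.det_transpose, Matrix.det_apply, Matrix.det_apply, Finset.sum_mul, Finset.mul_sum,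
    Finset.sum_mul, map_sum, map_sum]
  refine Finset.sum_congr rfl fun σ _ => ?_
  simp only [Units.smul_def, smul_mul_assoc, mul_smul_comm, map_zsmul]
  congr 1
  rw [← Lam_rename h A σ]
  simp only [map_mul, hQ, mono, map_prod, map_pow, MvPolynomial.rename_X, Matrix.transpose_apply,
    Matrix.of_apply]
  rw [Equiv.prod_comp σ (fun i => (MvPolynomial.X i : MvPolynomial (Fin r) R) ^ (i.rev : ℕ))]

/-- Indicator of a finset. -/
def ind {r : ℕ} (I : Finset (Fin r)) (i : Fin r) : ℕ := if i ∈ I then 1 else 0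

lemma mono_add_ind {R : Type} [CommRing R] {r : ℕ} (e : Fin r → ℕ) (I : Finset (Fin r)) :
    mono R (fun i => e i + ind I i) = mono R e * ∏ i ∈ I, MvPolynomial.X i := by
  unfold mono ind
  simp only [pow_add, Finset.prod_mul_distrib]
  congr 1
  simp [pow_ite]

lemma esymm_mul {R : Type} [CommRing R] {r p : ℕ} (e : Fin r → ℕ) :
    mono R e * MvPolynomial.esymm (Fin r) R p
      = ∑ I ∈ powersetCard p univ, mono R (fun i => e i + ind I i) := by
  simp only [mono_add_ind, MvPolynomial.esymm, Finset.mul_sum]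

lemma Kp_X_symm {R : Type} [CommRing R] {r : ℕ} (σ : Equiv.Perm (Fin r)) :
    MvPolynomial.rename σ (Kp (MvPolynomial.X : Fin r → MvPolynomial (Fin r) R))
      = Kp MvPolynomial.X := by
  have := map_Kp (MvPolynomial.rename (R := R) σ).toRingHom (MvPolynomial.X : Fin r → _)
  have h2 := Kp_comp_perm (MvPolynomial.X : Fin r → MvPolynomial (Fin r) R) σ
  rw [← h2]
  refine Eq.trans ?_ (this.trans ?_)
  · rw [h2]; rfl
  · simp

lemma littlewood_ideal {R : Type} [CommRing R] (M r : ℕ) :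
    (∑ m : Fin r → Fin M, (Matrix.of fun i j : Fin r => (MvPolynomial.X i : MvPolynomial (Fin r) R)
       ^ (2 * pre (fun k => (m k : ℕ)) j + (j : ℕ))).det) * Kp MvPolynomial.X
      - (Matrix.of fun i j : Fin r => (MvPolynomial.X i : MvPolynomial (Fin r) R) ^ (j : ℕ)).det
    ∈ Ideal.span (Set.range fun i : Fin r => (MvPolynomial.X i ^ M : MvPolynomial (Fin r) R)) := by
  set J := Ideal.span (Set.range fun i : Fin r => (MvPolynomial.X i ^ M : MvPolynomial (Fin r) R))
  rw [← Ideal.Quotient.eq_zero_iff_mem, map_sub, map_mul, map_sum, map_Kp, sub_eq_zero]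
  have := littlewood (B := MvPolynomial (Fin r) R ⧸ J) M
    (fun i => Ideal.Quotient.mk J (MvPolynomial.X i)) (by
      intro i
      rw [← map_pow, Ideal.Quotient.eq_zero_iff_mem]
      exact Ideal.subset_span ⟨i, rfl⟩)
  simp only [RingHom.map_det]
  have e1 : ∀ E : Fin r → ℕ, (Ideal.Quotient.mk J).mapMatrix (Matrix.of fun i j : Fin r =>
      (MvPolynomial.X i : MvPolynomial (Fin r) R) ^ E j)
      = Matrix.of fun i j : Fin r => (Ideal.Quotient.mk J (MvPolynomial.X i)) ^ E j := by
    intro E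
    ext i j
    simp
  simp only [e1]
  exact this

lemma main1 {R : Type} [CommRing R] (h : ℤ → R) (hneg : ∀ m < 0, h m = 0) (c r p : ℕ) :
    ∑ m : Fin r → Fin (c + r), ∑ I ∈ powersetCard p univ,
      Odet h c (fun j : Fin r => 2 * pre (fun k => (m k : ℕ)) j + (j : ℕ) + ind I j)
    = ∑ I ∈ powersetCard p univ, Sdet h c (fun j : Fin r => (j : ℕ) + ind I j) := by
  set A : ℤ := (c:ℤ) + r - 1 with hA
  set E := MvPolynomial.esymm (Fin r) R p with hE
  have hEs : ∀ σ : Equiv.Perm (Fin r), MvPolynomial.rename σ E = E :=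
    MvPolynomial.esymm_isSymmetric _ _ _
  have h1 : ∀ e : Fin r → ℕ, ∑ I ∈ powersetCard p univ, Odet h c (fun j => e j + ind I j)
      = Lam h A r ((Matrix.of fun i j : Fin r =>
        (MvPolynomial.X i : MvPolynomial (Fin r) R) ^ e j).det *
          (mono R (fun j => (j.rev : ℕ)) * (Kp MvPolynomial.X * E))) := by
    intro e
    rw [← Lam_swap h A e _ (fun σ => by rw [map_mul, hEs, Kp_X_symm])]
    have : mono R e * (Dl R r * (Kp MvPolynomial.X * E))
      = (mono R e * E) * (Dl R r * Kp MvPolynomial.X) := by ring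
    rw [this, hE, esymm_mul, Finset.sum_mul, map_sum]
    exact Finset.sum_congr rfl fun I _ => (Lam_O h c _).symm
  have h2 : ∑ I ∈ powersetCard p univ, Sdet h c (fun j : Fin r => (j : ℕ) + ind I j)
      = Lam h A r ((Matrix.of fun i j : Fin r =>
        (MvPolynomial.X i : MvPolynomial (Fin r) R) ^ (j : ℕ)).det *
          (mono R (fun j => (j.rev : ℕ)) * E)) := by
    rw [← Lam_swap h A (fun j : Fin r => (j : ℕ)) _ hEs]
    have : mono R (fun j : Fin r => (j : ℕ)) * (Dl R r * E)
      = (mono R (fun j : Fin r => (j : ℕ)) * E) * Dl R r := by ring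
    rw [this, hE, esymm_mul, Finset.sum_mul, map_sum]
    exact Finset.sum_congr rfl fun I _ => (Lam_S h c _).symm
  simp only [h1]
  rw [h2, ← map_sum, ← sub_eq_zero, ← map_sub, ← Finset.sum_mul]
  refine Lam_ideal h hneg A (c + r) (by push_cast; omega) _ ?_
  have := Ideal.mul_mem_right (mono R (fun j => (j.rev : ℕ)) * E) _
    (littlewood_ideal (R := R) (c + r) r)
  convert this using 1
  ring

lemma Odet_eq_zero_of_not_mono {R : Type} [CommRing R] (h : ℤ → R) (c : ℕ) {r : ℕ}
    (e : Fin r → ℕ) (i j : Fin r) (hij : i ≠ j) (he : e i = e j) : Odet h c e = 0 := by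
  unfold Odet
  refine Matrix.det_zero_of_row_eq hij ?_
  ext k; simp [he]

lemma Sdet_eq_zero_of_not_mono {R : Type} [CommRing R] (h : ℤ → R) (c : ℕ) {r : ℕ}
    (e : Fin r → ℕ) (i j : Fin r) (hij : i ≠ j) (he : e i = e j) : Sdet h c e = 0 := by
  unfold Sdet
  refine Matrix.det_zero_of_row_eq hij ?_
  ext k; simp [he]

lemma Odet_eq_zero_of_large {R : Type} [CommRing R] (h : ℤ → R) (hneg : ∀ m < 0, h m = 0)
    (c : ℕ) {r : ℕ} (e : Fin r → ℕ) (i : Fin r) (he : c + r ≤ e i) : Odet h c e = 0 := by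
  unfold Odet
  refine Matrix.det_eq_zero_of_row_eq_zero i fun j => ?_
  have := j.isLt
  rw [Matrix.of_apply, hneg _ (by omega), hneg _ (by omega), sub_zero]

/-- A sequence `s + 1_I` with `s` monotone that is not monotone has an adjacent witness. -/
lemma adj_witness {r : ℕ} (s : Fin r → ℕ) (hs : Monotone s) (d : ℕ) (hd : 1 ≤ d)
    (I : Finset (Fin r)) (hn : ¬ Monotone (fun j => d * s j + ind I j)) :
    ∃ i j : Fin r, (j : ℕ) = i + 1 ∧ s i = s j ∧ i ∈ I ∧ j ∉ I := by
  by_contra hcon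
  push Not at hcon
  apply hn
  rcases r with _ | r
  · intro i; exact i.elim0
  refine Fin.monotone_iff_le_succ.2 fun i => ?_
  have hle : s i.castSucc ≤ s i.succ := hs (Fin.castSucc_lt_succ).le
  have := hcon i.castSucc i.succ (by simp)
  have hI : ∀ k, ind I k ≤ 1 := fun k => by unfold ind; split <;> omega
  rcases hle.eq_or_lt with heq | hlt
  · have h3 : ind I i.castSucc ≤ ind I i.succ := by
      unfold ind
      by_cases hh : i.castSucc ∈ I
      · rw [if_pos (this heq hh)]; split <;> omega
      · rw [if_neg hh]; omega
    simp only [heq]; omega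
  · have : d * (s i.castSucc + 1) ≤ d * s i.succ := Nat.mul_le_mul_left _ hlt
    have := hI i.castSucc
    nlinarith

lemma sum_Sdet {R : Type} [CommRing R] (h : ℤ → R) (c r p : ℕ) (hpr : p ≤ r) :
    ∑ I ∈ powersetCard p univ, Sdet h c (fun j : Fin r => (j : ℕ) + ind I j)
    = Sdet h c (fun j : Fin r => (j : ℕ) + if (j : ℕ) < r - p then 0 else 1) := by
  let I0 : Finset (Fin r) := univ.filter fun j => ¬ (j : ℕ) < r - p
  have hcard : I0.card = p := by
    have h1 := Finset.card_filter_add_card_filter_not (s := (univ : Finset (Fin r)))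
      (fun j => (j : ℕ) < r - p)
    rw [Fin.card_filter_val_lt, Finset.card_univ, Fintype.card_fin] at h1
    simp only [I0]
    omega
  rw [Finset.sum_eq_single I0]
  · congr 1
    ext j
    simp only [ind, I0, Finset.mem_filter, Finset.mem_univ, true_and]
    split_ifs <;> simp_all
  · intro I hI hne
    have hIc : I.card = p := (Finset.mem_powersetCard.1 hI).2
    by_cases hm : Monotone (fun j => 1 * (fun _ : Fin r => 0) j + ind I j)
    · exfalso
      apply hne
      refine Finset.eq_of_subset_of_card_le ?_ (by omega)
      intro i hi
      simp only [I0, Finset.mem_filter, Finset.mem_univ, true_and]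
      have hsub : Finset.Ici i ⊆ I := by
        intro j hj
        have := hm (Finset.mem_Ici.1 hj)
        simp only [ind, if_pos hi] at this
        by_contra hj'
        simp [hj'] at this
      have := Finset.card_le_card hsub
      rw [Fin.card_Ici] at this
      omega
    · obtain ⟨i, j, hij, _, hi, hj⟩ := adj_witness (fun _ => 0) (fun _ _ _ => le_rfl) 1 le_rfl I hm
      refine Sdet_eq_zero_of_not_mono h c _ i j (by rintro rfl; omega) ?_
      simp [ind, hi, hj, hij]
  · intro hn
    exact absurd (Finset.mem_powersetCard.2 ⟨Finset.subset_univ _, hcard⟩) hn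

lemma sum_Odet {R : Type} [CommRing R] (h : ℤ → R) (hneg : ∀ m < 0, h m = 0) (c r p : ℕ) :
    ∑ ν ∈ ((Fintype.piFinset fun _ : Fin r => Finset.range (c + 1)).filter
            (fun ν => Antitone ν ∧ oddRowsCount c ν = p)),
      Odet h c (fun j => (c - ν j) + (j : ℕ))
    = ∑ m : Fin r → Fin (c + r), ∑ I ∈ powersetCard p univ,
      Odet h c (fun j : Fin r => 2 * pre (fun k => (m k : ℕ)) j + (j : ℕ) + ind I j) := by
  rw [← Finset.sum_product']
  let δ : (Fin r → Fin (c + r)) × Finset (Fin r) → Fin r → ℕ :=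
    fun x j => 2 * pre (fun k => (x.1 k : ℕ)) j + ind x.2 j
  rw [← Finset.sum_filter_of_ne (p := fun x => Monotone (δ x) ∧ ∀ j, δ x j ≤ c)]
  · symm
    refine Finset.sum_bij (fun x _ j => c - δ x j) ?_ ?_ ?_ ?_
    · intro x hx
      simp only [Finset.mem_filter, Finset.mem_product, Finset.mem_powersetCard] at hx
      obtain ⟨⟨_, _, hcard⟩, hmono, hle⟩ := hx
      simp only [Finset.mem_filter, Fintype.mem_piFinset, Finset.mem_range]
      refine ⟨fun j => by omega, fun i j hij => Nat.sub_le_sub_left (hmono hij) _, ?_⟩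
      unfold oddRowsCount
      rw [← hcard]
      congr 1
      ext j
      simp only [Finset.mem_filter, Finset.mem_univ, true_and]
      rw [Nat.cast_sub (hle j), sub_sub_cancel]
      simp only [δ, ind]
      split_ifs with hj
      · simp only [hj, iff_true]
        exact ⟨(pre (fun k => (x.1 k : ℕ)) j : ℤ), by push_cast; ring⟩
      · simp only [hj, iff_false, Int.not_odd_iff_even]
        exact ⟨(pre (fun k => (x.1 k : ℕ)) j : ℤ), by push_cast; ring⟩
    · intro x hx y hy hxy
      simp only [Finset.mem_filter] at hx hy
      have hd : ∀ j, δ x j = δ y j := by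
        intro j
        have h1 := congrFun hxy j
        have h2 := hx.2.2 j
        have h3 := hy.2.2 j
        omega
      have hI : ∀ (z : (Fin r → Fin (c + r)) × Finset (Fin r)) j, j ∈ z.2 ↔ δ z j % 2 = 1 := by
        intro z j
        simp only [δ, ind]
        split_ifs with hj <;> simp only [hj, true_iff, false_iff] <;> omega
      have e2 : x.2 = y.2 := by
        ext j
        rw [hI x, hI y, hd]
      have e1 : (fun k => (x.1 k : ℕ)) = fun k => (y.1 k : ℕ) := by
        apply pre_inj
        ext j
        have := hd j
        simp only [δ, e2] at this
        omega
      refine Prod.ext ?_ e2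
      ext k
      exact congrFun e1 k
    · intro ν hν
      simp only [Finset.mem_filter, Fintype.mem_piFinset, Finset.mem_range] at hν
      obtain ⟨hle, hanti, hodd⟩ := hν
      obtain ⟨m, hm, hmle⟩ := pre_surj (fun j => (c - ν j) / 2) (fun i j hij =>
        Nat.div_le_div_right (Nat.sub_le_sub_left (hanti hij) _))
      let x : (Fin r → Fin (c + r)) × Finset (Fin r) :=
        (fun k => ⟨m k, by have := hmle k; have := k.isLt; omega⟩,
          univ.filter (fun i : Fin r => Odd ((c : ℤ) - (ν i : ℤ))))
      have hx : ∀ j, δ x j = c - ν j := by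
        intro j
        simp only [δ, x, hm, ind, Finset.mem_filter, Finset.mem_univ, true_and]
        have := hle j
        have hiff : Odd ((c : ℤ) - (ν j : ℤ)) ↔ Odd (c - ν j) := by
          rw [← Nat.cast_sub (by omega : ν j ≤ c), Int.odd_coe_nat]
        split_ifs with hj
        · rw [hiff, Nat.odd_iff] at hj; omega
        · rw [hiff, Nat.odd_iff] at hj; omega
      refine ⟨x, ?_, ?_⟩
      · simp only [Finset.mem_filter, Finset.mem_product, Finset.mem_powersetCard]
        refine ⟨⟨Finset.mem_univ _, Finset.subset_univ _, hodd⟩, ?_, ?_⟩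
        · intro i j hij
          rw [hx, hx]
          exact Nat.sub_le_sub_left (hanti hij) _
        · intro j; rw [hx]; omega
      · ext j
        have := hle j
        simp only [hx]; omega
    · intro x hx
      simp only [Finset.mem_filter] at hx
      congr 1
      ext j
      have := hx.2.2 j
      have h2 : δ x j = 2 * pre (fun k => (x.1 k : ℕ)) j + ind x.2 j := rfl
      simp only
      omega
  · intro x _ hne
    have hmono : Monotone (δ x) := by
      by_contra hn
      obtain ⟨i, j, hij, hs, hi, hj⟩ := adj_witness _ (pre_mono _) 2 (by norm_num) _ hn
      apply hne
      refine Odet_eq_zero_of_not_mono h c _ i j (by rintro rfl; omega) ?_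
      simp only [ind, hi, hj, hij, hs, if_true, if_false]
      omega
    refine ⟨hmono, fun j => ?_⟩
    by_contra hlt
    apply hne
    have hr : 0 < r := j.pos
    let l : Fin r := ⟨r - 1, by omega⟩
    have hl : δ x j ≤ δ x l := hmono (Fin.le_def.2 (by have := j.isLt; simp only [l]; omega))
    refine Odet_eq_zero_of_large h hneg c _ l ?_
    have h2 : δ x l = 2 * pre (fun k => (x.1 k : ℕ)) l + ind x.2 l := rfl
    have h3 : (l : ℕ) = r - 1 := rfl
    omega

/-- `s_N((c^{r-p},(c-1)^p); x^{±1}) = ∑_{ν ⊆ (c^r), oddrows((c^r)/ν)=p}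
o_N(ν; x^{±1})`. -/
theorem schurLaurent_eq_sum_oCharLaurent
    (N r c p : ℕ) (hN : 2 ≤ N) (hc : 1 ≤ c) (hpr : p ≤ r) (hrN : r ≤ N / 2)
    (R : Type) [CommRing R] (x : Fin (N / 2) → Rˣ) :
    schur (fun i : Fin r => if (i : ℕ) < r - p then (c : ℤ) else (c : ℤ) - 1)
        (xpm (N / 2) N x)
      = ∑ ν ∈ ((Fintype.piFinset fun _ : Fin r => Finset.range (c + 1)).filter
            (fun ν => Antitone ν ∧ oddRowsCount c ν = p)),
          oChar (fun i => (ν i : ℤ)) (xpm (N / 2) N x) := by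
  have hneg : ∀ m < 0, hpoly (xpm (N / 2) N x) m = 0 := by
    intro m hm
    unfold hpoly
    rw [if_neg (by omega)]
  have h1 := sum_Odet (hpoly (xpm (N / 2) N x)) hneg c r p
  rw [main1 _ hneg, sum_Sdet _ c r p hpr] at h1
  have h2 : schur (fun i : Fin r => if (i : ℕ) < r - p then (c : ℤ) else (c : ℤ) - 1)
        (xpm (N / 2) N x)
      = Sdet (hpoly (xpm (N / 2) N x)) c
        (fun j : Fin r => (j : ℕ) + if (j : ℕ) < r - p then 0 else 1) := by
    unfold schur Sdet
    congr 2
    ext i j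
    congr 1
    dsimp only
    split_ifs <;> push_cast <;> ring
  rw [h2, ← h1]
  refine Finset.sum_congr rfl fun ν hν => ?_
  have hle : ∀ i, ν i ≤ c := by
    intro i
    have := Fintype.mem_piFinset.1 (Finset.mem_filter.1 hν).1 i
    rw [Finset.mem_range] at this
    omega
  unfold oChar Odet
  congr 2
  ext i j
  push_cast [Nat.cast_sub (hle i)]
  congr 2 <;> ring

end
end

section
/- Let n, c, p be nonnegative integers with n ≥ p, and with c ≥ 1 if p ≥ 1. Then, as an identity of rational functions in x_1,…,x_n, sp_{2n}((c^{n−p},(c−1)^p); x^{±1}) = (x_1 x_2 ⋯ x_n)^{−c} · Σ_ν s_n(ν; x), where the sum ranges over all partitions ν with at most n parts, each part at most 2c, having exactly p odd parts. -/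
open scoped Classical
open Finset

noncomputable section

/-- The field of rational functions in `n` variables over `ℚ`. -/
abbrev FF (n : ℕ) : Type := FractionRing (MvPolynomial (Fin n) ℚ)

/-- The variables, as elements of the rational function field. -/
def Xv (n : ℕ) : Fin n → FF n := fun i =>
  algebraMap (MvPolynomial (Fin n) ℚ) (FF n) (MvPolynomial.X i)

/-- Irreducible symplectic character `sp_{2n}(λ; x^{±1})` via the Weyl character formula. -/
def spWeyl {F : Type} [Field F] (n : ℕ) (lam : Fin n → ℤ) (x : Fin n → F) : F :=
  Matrix.det (Matrix.of fun i j : Fin n =>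
    x j ^ (lam i + (n : ℤ) - ((i : ℕ) : ℤ)) - x j ^ (-(lam i + (n : ℤ) - ((i : ℕ) : ℤ)))) /
  Matrix.det (Matrix.of fun i j : Fin n =>
    x j ^ ((n : ℤ) - ((i : ℕ) : ℤ)) - x j ^ (-((n : ℤ) - ((i : ℕ) : ℤ))))



/-! ### Helper material -/

namespace NearRect

variable {F : Type} [Field F]

/-- product over pairs `i < j` -/
def pp {n : ℕ} (f : Fin n → Fin n → F) : F :=
  ∏ i, ∏ j, if i < j then f i j else 1

lemma pp_succAbove {n : ℕ} (f : Fin (n + 1) → Fin (n + 1) → F) (k : Fin (n + 1)) :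
    pp f = (∏ j, if k < k.succAbove j then f k (k.succAbove j) else f (k.succAbove j) k) *
      pp (fun i j => f (k.succAbove i) (k.succAbove j)) := by
  unfold pp
  rw [Fin.prod_univ_succAbove _ k]
  rw [Fin.prod_univ_succAbove _ k]
  simp only [lt_irrefl, if_false, one_mul]
  have h : ∀ i : Fin n, (∏ j, if k.succAbove i < j then f (k.succAbove i) j else 1) =
      (if k.succAbove i < k then f (k.succAbove i) k else 1) *
        ∏ j, if i < j then f (k.succAbove i) (k.succAbove j) else 1 := by
    intro i
    rw [Fin.prod_univ_succAbove _ k]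
    simp only [Fin.succAbove_lt_succAbove_iff]
  simp only [h, Finset.prod_mul_distrib]
  rw [← mul_assoc, ← Finset.prod_mul_distrib]
  congr 1
  refine Finset.prod_congr rfl fun j _ => ?_
  rcases lt_or_gt_of_ne (Fin.succAbove_ne k j) with h1 | h1
  · simp [h1, not_lt_of_gt h1]
  · simp [h1, not_lt_of_gt h1]

/-- Vandermonde product -/
def V {n : ℕ} (z : Fin n → F) : F := pp (fun i j => z i - z j)

/-- denominators -/
def B {n : ℕ} (x : Fin n → F) : F :=
  (∏ j, (x j - (x j)⁻¹)) * pp (fun i j => 1 - (x i)⁻¹ * (x j)⁻¹)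

lemma sign_prod {n : ℕ} (k : Fin (n + 1)) :
    (∏ j : Fin n, if k < k.succAbove j then (1 : F) else -1) = (-1) ^ (k : ℕ) := by
  rw [Finset.prod_ite]
  simp only [Finset.prod_const, one_pow, one_mul]
  congr 1
  have : (Finset.univ.filter fun j : Fin n => ¬ k < k.succAbove j) =
      Finset.univ.filter fun j : Fin n => (j : ℕ) < k := by
    ext j
    simp only [Finset.mem_filter, Finset.mem_univ, true_and]
    rw [Fin.lt_succAbove_iff_le_castSucc]
    simp [Fin.lt_def]
  rw [this, Fin.card_filter_val_lt]
  have := k.isLt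
  omega

lemma V_succAbove {n : ℕ} (z : Fin (n + 1) → F) (k : Fin (n + 1)) :
    V z = (-1) ^ (k : ℕ) * (∏ j, (z k - z (k.succAbove j))) * V (fun j => z (k.succAbove j)) := by
  unfold V
  rw [pp_succAbove _ k, ← sign_prod, ← Finset.prod_mul_distrib]
  congr 1
  refine Finset.prod_congr rfl fun j _ => ?_
  split_ifs <;> ring

lemma B_succAbove {n : ℕ} (x : Fin (n + 1) → F) (k : Fin (n + 1)) :
    B x = (x k - (x k)⁻¹) * (∏ j, (1 - (x k)⁻¹ * (x (k.succAbove j))⁻¹)) *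
      B (fun j => x (k.succAbove j)) := by
  unfold B
  rw [pp_succAbove _ k, Fin.prod_univ_succAbove _ k]
  have : (∏ j, if k < k.succAbove j then 1 - (x k)⁻¹ * (x (k.succAbove j))⁻¹
      else 1 - (x (k.succAbove j))⁻¹ * (x k)⁻¹) =
      ∏ j, (1 - (x k)⁻¹ * (x (k.succAbove j))⁻¹) := by
    refine Finset.prod_congr rfl fun j _ => ?_
    split_ifs <;> ring
  rw [this]
  ring

lemma det_V {n : ℕ} (z : Fin n → F) :
    Matrix.det (Matrix.of fun i j : Fin n => z j ^ ((Fin.rev i : Fin n) : ℕ)) = V z := by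
  rw [← Matrix.det_transpose]
  have := Matrix.det_projVandermonde (R := F) (fun _ : Fin n => 1) z
  have h2 : (Matrix.of fun i j : Fin n => z j ^ ((Fin.rev i : Fin n) : ℕ)).transpose =
    Matrix.projVandermonde (fun _ : Fin n => 1) z := by
    ext i j
    simp [Matrix.projVandermonde_apply]
  rw [h2, this, V, pp]
  refine Finset.prod_congr rfl fun i _ => ?_
  rw [← Finset.prod_filter]
  refine Finset.prod_congr ?_ fun j _ => by ring
  ext j; simp

/-- Lagrange interpolation identity -/
lemma lagr {m : ℕ} (a b : Fin (m + 1) → F) (hb : Function.Injective b) (t : F) :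
    ∏ j, (t - a j) - ∏ j, (t - b j) = ∑ k, (∏ j, (b k - a j)) *
      ∏ j, ((t - b (k.succAbove j)) / (b k - b (k.succAbove j))) := by
  let f : Polynomial F := Lagrange.nodal Finset.univ a - Lagrange.nodal Finset.univ b
  have hd : f.degree < ((Finset.univ : Finset (Fin (m + 1))).card : WithBot ℕ) := by
    have := Polynomial.degree_sub_lt_left (p := Lagrange.nodal Finset.univ a)
      (q := Lagrange.nodal Finset.univ b) (by simp [Lagrange.degree_nodal])
      Lagrange.nodal_ne_zero (by
        rw [Lagrange.nodal_monic.leadingCoeff, Lagrange.nodal_monic.leadingCoeff])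
    rwa [Lagrange.degree_nodal] at this
  have h := Lagrange.eq_interpolate (s := Finset.univ) (v := b) hb.injOn hd
  have h2 := congrArg (Polynomial.eval t) h
  simp only [f, Polynomial.eval_sub, Lagrange.eval_nodal, Lagrange.interpolate_apply,
    Polynomial.eval_finsetSum, Polynomial.eval_mul, Polynomial.eval_C] at h2
  rw [h2]
  refine Finset.sum_congr rfl fun k _ => ?_
  have h0 : ∏ j, (b k - b j) = 0 := Finset.prod_eq_zero (Finset.mem_univ k) (sub_self _)
  rw [h0, sub_zero]
  congr 1
  rw [Lagrange.basis, Polynomial.eval_prod]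
  have : (Finset.univ.erase k : Finset (Fin (m + 1))) =
      Finset.univ.map (Fin.succAboveEmb k) := by
    ext j
    simp [Fin.exists_succAbove_eq_iff]
  rw [this, Finset.prod_map]
  refine Finset.prod_congr rfl fun j _ => ?_
  simp [Lagrange.basisDivisor]
  ring

/-- `x` or its inverse -/
def zz {n : ℕ} (x : Fin n → F) (e : Fin n → Bool) : Fin n → F :=
  fun j => if e j then x j else (x j)⁻¹

/-- sign -/
def sg (b : Bool) : F := if b then 1 else -1

lemma det_expand {n : ℕ} (x : Fin n → F) (a : Fin n → ℕ) :
    Matrix.det (Matrix.of fun i j : Fin n => x j ^ (a i) - ((x j)⁻¹) ^ (a i)) =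
      ∑ e : Fin n → Bool, (∏ j, sg (e j)) *
        Matrix.det (Matrix.of fun i j : Fin n => zz x e j ^ (a i)) := by
  simp only [Matrix.det_apply, Matrix.of_apply]
  have h : ∀ σ : Equiv.Perm (Fin n), (∏ j, (x j ^ (a (σ j)) - ((x j)⁻¹) ^ (a (σ j)))) =
      ∑ e : Fin n → Bool, (∏ j, sg (e j)) * ∏ j, zz x e j ^ (a (σ j)) := by
    intro σ
    have : ∀ j, x j ^ (a (σ j)) - ((x j)⁻¹) ^ (a (σ j)) =
      ∑ b : Bool, sg b * (if b then x j else (x j)⁻¹) ^ (a (σ j)) := by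
      intro j; simp [sg]; ring
    simp only [this]
    rw [Finset.prod_univ_sum]
    simp only [Fintype.piFinset_univ, ← Finset.prod_mul_distrib, zz]
  simp only [h, Finset.smul_sum, Finset.mul_sum]
  rw [Finset.sum_comm]
  refine Finset.sum_congr rfl fun e _ => Finset.sum_congr rfl fun σ _ => ?_
  rw [mul_smul_comm]

/-- genericity -/
structure Good {n : ℕ} (x : Fin n → F) : Prop where
  ne0 : ∀ j, x j ≠ 0
  inj : Function.Injective x
  mul : ∀ i j, x i * x j ≠ 1

lemma Good.sA {n : ℕ} {x : Fin (n + 1) → F} (h : Good x) (k : Fin (n + 1)) :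
    Good (fun j => x (k.succAbove j)) where
  ne0 _ := h.ne0 _
  inj := h.inj.comp Fin.succAbove_right_injective
  mul _ _ := h.mul _ _

lemma Good.B_ne {n : ℕ} {x : Fin n → F} (h : Good x) : B x ≠ 0 := by
  unfold B pp
  refine mul_ne_zero (Finset.prod_ne_zero_iff.2 fun j _ => ?_)
    (Finset.prod_ne_zero_iff.2 fun i _ => Finset.prod_ne_zero_iff.2 fun j _ => ?_)
  · intro h0
    have h1 := h.ne0 j
    have : x j * x j - x j * (x j)⁻¹ = 0 := by rw [← mul_sub, h0, mul_zero]
    rw [mul_inv_cancel₀ h1] at this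
    exact h.mul j j (sub_eq_zero.1 this)
  · split_ifs
    · intro h0
      have h1 := h.ne0 j
      have h2 := h.ne0 i
      apply h.mul i j
      rw [sub_eq_zero, ← mul_inv, eq_comm, inv_eq_one] at h0
      exact h0
    · exact one_ne_zero

lemma V_ne {n : ℕ} {x : Fin n → F} (h : Function.Injective x) : V x ≠ 0 := by
  unfold V pp
  refine Finset.prod_ne_zero_iff.2 fun i _ => Finset.prod_ne_zero_iff.2 fun j _ => ?_
  split_ifs with hij
  · exact sub_ne_zero.2 (h.ne hij.ne)
  · exact one_ne_zero

lemma zz_ne0 {n : ℕ} {x : Fin n → F} (h : Good x) (e : Fin n → Bool) (j) : zz x e j ≠ 0 := by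
  unfold zz; split_ifs
  · exact h.ne0 j
  · exact inv_ne_zero (h.ne0 j)

lemma zz_inj {n : ℕ} {x : Fin n → F} (h : Good x) (e : Fin n → Bool) :
    Function.Injective (zz x e) := by
  intro i j hij
  have hi := h.ne0 i
  have hj := h.ne0 j
  unfold zz at hij
  split_ifs at hij
  · exact h.inj hij
  · exact absurd (by rw [hij, inv_mul_cancel₀ hj]) (h.mul i j)
  · exact absurd (by rw [← hij, mul_inv_cancel₀ hi]) (h.mul i j)
  · exact h.inj (inv_injective hij)

/-- even closed form -/
def EE {n : ℕ} (c : ℕ) (y : F) (x : Fin n → F) : F :=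
  ∑ e : Fin n → Bool,
    (∏ j, (sg (e j) * (x j * zz x e j) ^ c * (zz x e j + y))) * (V (zz x e) / B x)

/-- odd closed form -/
def OO {n : ℕ} (c : ℕ) (y : F) (x : Fin n → F) : F :=
  ∑ e : Fin n → Bool,
    (∏ j, (sg (e j) * (x j * zz x e j) ^ c * ((x j)⁻¹ + y))) * (V (zz x e) / B x)

lemma sum_swap {n : ℕ} (a : Fin (n + 1) → F) (g : Fin (n + 1) → (Fin n → Bool) → F) :
    ∑ k, a k * ∑ e', g k e' =
      ∑ e : Fin (n + 1) → Bool, ∑ k, if e k then a k * g k (fun j => e (k.succAbove j)) else 0 := by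
  rw [Finset.sum_comm]
  refine Finset.sum_congr rfl fun k _ => ?_
  rw [← (Fin.insertNthEquiv (fun _ => Bool) k).sum_comp, Fintype.sum_prod_type]
  simp [Fin.insertNthEquiv, Finset.mul_sum]

lemma term_ratio {n : ℕ} {x : Fin (n + 1) → F} (h : Good x) (e : Fin (n + 1) → Bool)
    (k : Fin (n + 1)) (hk : e k = true) :
    (-1) ^ (k : ℕ) * x k ^ n * (V (fun j => zz x e (k.succAbove j)) /
      B (fun j => x (k.succAbove j))) =
    V (zz x e) / B x * ((x k - (x k)⁻¹) *
      ∏ j, ((x k - (x (k.succAbove j))⁻¹) / (x k - zz x e (k.succAbove j)))) := by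
  have hB := h.B_ne
  have hB' := (h.sA k).B_ne
  have hzk : zz x e k = x k := by simp [zz, hk]
  have hz := zz_inj h e
  have hd : ∏ j, (x k - zz x e (k.succAbove j)) ≠ 0 := by
    refine Finset.prod_ne_zero_iff.2 fun j _ => sub_ne_zero.2 ?_
    rw [← hzk]
    exact hz.ne (Fin.succAbove_ne k j).symm
  have hx : (∏ j, (x k - (x (k.succAbove j))⁻¹)) =
      x k ^ n * ∏ j, (1 - (x k)⁻¹ * (x (k.succAbove j))⁻¹) := by
    have : x k ^ n = ∏ _j : Fin n, x k := by simp
    rw [this, ← Finset.prod_mul_distrib]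
    refine Finset.prod_congr rfl fun j _ => ?_
    rw [mul_sub, ← mul_assoc, mul_inv_cancel₀ (h.ne0 k)]
    ring
  have hsq : ((-1 : F)) ^ (k : ℕ) * (-1) ^ (k : ℕ) = 1 := by
    rw [← mul_pow]; simp
  rw [Finset.prod_div_distrib, hx]
  have hV := V_succAbove (zz x e) k
  rw [hzk] at hV
  have hBB := B_succAbove x k
  rw [hBB] at hB
  rw [hV, hBB]
  have h1 := left_ne_zero_of_mul (left_ne_zero_of_mul hB)
  have h2 := right_ne_zero_of_mul (left_ne_zero_of_mul hB)
  generalize (∏ j, (x k - zz x e (k.succAbove j))) = p1 at *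
  generalize (∏ j, (1 - (x k)⁻¹ * (x (k.succAbove j))⁻¹)) = p2 at *
  generalize x k - (x k)⁻¹ = p3 at *
  generalize (B fun j => x (k.succAbove j)) = p4 at *
  field_simp

lemma evenL {n : ℕ} {x : Fin (n + 1) → F} (h : Good x) (e : Fin (n + 1) → Bool) (y : F) :
    ∏ j, (zz x e j + y) - ∏ j, ((x j)⁻¹ + y) =
      ∑ k, if e k then (x k - (x k)⁻¹) *
        (∏ j, ((x k - (x (k.succAbove j))⁻¹) / (x k - zz x e (k.succAbove j)))) *
        ∏ j, (zz x e (k.succAbove j) + y) else 0 := by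
  have L := lagr (fun j => (x j)⁻¹) (zz x e) (zz_inj h e) (-y)
  have s1 : ∀ {m : ℕ} (f : Fin m → F), ∏ j, (-y - f j) = (-1) ^ m * ∏ j, (f j + y) := by
    intro m f
    have : ((-1) ^ m : F) = ∏ _j : Fin m, (-1) := by simp
    rw [this, ← Finset.prod_mul_distrib]
    exact Finset.prod_congr rfl fun j _ => by ring
  simp only [Finset.prod_div_distrib] at L ⊢
  simp only [s1] at L
  have h1 : ((-1) ^ n : F) ≠ 0 := by simp
  apply mul_left_cancel₀ h1
  rw [pow_succ] at L
  calc _ = (-1) ^ n * -1 * ∏ j, ((x j)⁻¹ + y) - (-1) ^ n * -1 * ∏ j, (zz x e j + y) := by ring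
    _ = _ := by
      rw [L, Finset.mul_sum]
      refine Finset.sum_congr rfl fun k _ => ?_
      rw [Fin.prod_univ_succAbove _ k]
      cases hk : e k
      · simp [zz, hk]
      · have hzk : zz x e k = x k := by simp [zz, hk]
        rw [hzk]
        simp only [if_true]
        ring

lemma oddL {n : ℕ} {x : Fin (n + 1) → F} (h : Good x) (e : Fin (n + 1) → Bool) (y : F) :
    ∏ j, (zz x e j + y * (x j * zz x e j)) - ∏ j, (zz x e j + y) =
      ∑ k, if e k then y * x k * ((x k - (x k)⁻¹) *
        (∏ j, ((x k - (x (k.succAbove j))⁻¹) / (x k - zz x e (k.succAbove j)))) *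
        ∏ j, (zz x e (k.succAbove j) + y * (x (k.succAbove j) * zz x e (k.succAbove j)))) else 0 := by
  by_cases hy : y = 0
  · simp [hy]
  have L := lagr (fun j => (zz x e j)⁻¹) x h.inj (-y⁻¹)
  have hz := zz_ne0 h e
  have e1 : ∏ j, (zz x e j + y) = (∏ j, (-y * zz x e j)) * ∏ j, (-y⁻¹ - (zz x e j)⁻¹) := by
    rw [← Finset.prod_mul_distrib]
    refine Finset.prod_congr rfl fun j _ => ?_
    have := hz j
    field_simp
    ring
  have e2 : ∏ j, (zz x e j + y * (x j * zz x e j)) =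
      (∏ j, (-y * zz x e j)) * ∏ j, (-y⁻¹ - x j) := by
    rw [← Finset.prod_mul_distrib]
    refine Finset.prod_congr rfl fun j _ => ?_
    have := hz j
    field_simp
    ring
  rw [e1, e2, ← mul_sub, ← neg_sub, L, ← Finset.sum_neg_distrib, Finset.mul_sum]
  refine Finset.sum_congr rfl fun k _ => ?_
  rw [Fin.prod_univ_succAbove (fun j => -y * zz x e j) k,
    Fin.prod_univ_succAbove (fun j => x k - (zz x e j)⁻¹) k]
  cases hk : e k
  · simp [zz, hk]
  · have hzk : zz x e k = x k := by simp [zz, hk]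
    rw [hzk]
    simp only [if_true]
    have e3 : (∏ j, ((x k - (x (k.succAbove j))⁻¹) / (x k - zz x e (k.succAbove j)))) *
        ∏ j, (zz x e (k.succAbove j) + y * (x (k.succAbove j) * zz x e (k.succAbove j))) =
        (∏ j, (-y * zz x e (k.succAbove j))) * (∏ j, (x k - (zz x e (k.succAbove j))⁻¹)) *
        ∏ j, ((-y⁻¹ - x (k.succAbove j)) / (x k - x (k.succAbove j))) := by
      simp only [← Finset.prod_mul_distrib]
      refine Finset.prod_congr rfl fun j _ => ?_
      have hzz := hz (k.succAbove j)
      have hz2 : x k - zz x e (k.succAbove j) ≠ 0 := by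
        rw [← hzk]; exact sub_ne_zero.2 ((zz_inj h e).ne (Fin.succAbove_ne k j).symm)
      have hx2 : x k - x (k.succAbove j) ≠ 0 :=
        sub_ne_zero.2 (h.inj.ne (Fin.succAbove_ne k j).symm)
      have hx0 := h.ne0 (k.succAbove j)
      cases hj : e (k.succAbove j)
      · have : zz x e (k.succAbove j) = (x (k.succAbove j))⁻¹ := by simp [zz, hj]
        rw [this] at hz2 ⊢
        rw [inv_inv, div_self hz2]
        field_simp
        ring
      · have : zz x e (k.succAbove j) = x (k.succAbove j) := by simp [zz, hj]
        rw [this]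
        field_simp
        ring
    linear_combination (-(y * x k * (x k - (x k)⁻¹))) * e3

lemma EE_step {n : ℕ} {x : Fin (n + 1) → F} (h : Good x) (c : ℕ) (y : F) :
    EE c y x = OO c y x + ∑ k : Fin (n + 1), (-1) ^ (k : ℕ) * x k ^ (2 * c + n) *
      EE c y (fun j => x (k.succAbove j)) := by
  unfold EE OO
  rw [sum_swap, ← Finset.sum_add_distrib]
  refine Finset.sum_congr rfl fun e _ => ?_
  rw [← sub_eq_iff_eq_add']
  simp only [Finset.prod_mul_distrib (g := fun j => zz x e j + y),
    Finset.prod_mul_distrib (g := fun j => (x j)⁻¹ + y)]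
  rw [← sub_mul, ← mul_sub, evenL h, Finset.mul_sum, Finset.sum_mul]
  refine Finset.sum_congr rfl fun k _ => ?_
  cases hk : e k
  · simp
  · have hzk : zz x e k = x k := by simp [zz, hk]
    have R := term_ratio h e k hk
    simp only [if_true]
    rw [Fin.prod_univ_succAbove _ k, hzk, hk]
    have hz' : (zz (fun j => x (k.succAbove j)) fun j => e (k.succAbove j)) =
      fun j => zz x e (k.succAbove j) := rfl
    rw [hz']
    simp only [Finset.prod_mul_distrib (g := fun j => zz x e (k.succAbove j) + y)]
    have hs : (sg true : F) = 1 := rfl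
    rw [hs, pow_add, ← pow_two, ← pow_mul]
    linear_combination (-1) * x k ^ (2 * c) *
      (∏ j, (sg (e (k.succAbove j)) * (x (k.succAbove j) * zz x e (k.succAbove j)) ^ c)) *
      (∏ j, (zz x e (k.succAbove j) + y)) * R

lemma OO_step {n : ℕ} {x : Fin (n + 1) → F} (h : Good x) (c : ℕ) (y : F) :
    OO (c + 1) y x = EE c y x + y * ∑ k : Fin (n + 1), (-1) ^ (k : ℕ) * x k ^ (2 * c + 1 + n) *
      OO (c + 1) y (fun j => x (k.succAbove j)) := by
  unfold EE OO
  rw [sum_swap, Finset.mul_sum, ← Finset.sum_add_distrib]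
  refine Finset.sum_congr rfl fun e _ => ?_
  rw [← sub_eq_iff_eq_add']
  have key : ∀ j, sg (e j) * (x j * zz x e j) ^ (c + 1) * ((x j)⁻¹ + y) =
      (sg (e j) * (x j * zz x e j) ^ c) * (zz x e j + y * (x j * zz x e j)) := by
    intro j
    have := h.ne0 j
    field_simp
    ring
  have hz' : ∀ k : Fin (n + 1), (zz (fun j => x (k.succAbove j)) fun j => e (k.succAbove j)) =
      fun j => zz x e (k.succAbove j) := fun _ => rfl
  simp only [hz', key]
  simp only [Finset.prod_mul_distrib (g := fun j => zz x e j + y),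
    Finset.prod_mul_distrib (g := fun j => zz x e j + y * (x j * zz x e j))]
  rw [← sub_mul, ← mul_sub, oddL h, Finset.mul_sum, Finset.sum_mul, Finset.mul_sum]
  refine Finset.sum_congr rfl fun k _ => ?_
  cases hk : e k
  · simp
  · have hzk : zz x e k = x k := by simp [zz, hk]
    have R := term_ratio h e k hk
    simp only [if_true]
    rw [Fin.prod_univ_succAbove _ k, hzk, hk]
    simp only [Finset.prod_mul_distrib
      (g := fun j => zz x e (k.succAbove j) + y * (x (k.succAbove j) * zz x e (k.succAbove j)))]
    have hs : (sg true : F) = 1 := rfl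
    rw [hs, pow_add, ← pow_two, ← pow_mul]
    linear_combination (-1) * y * x k ^ (2 * c + 1) *
      (∏ j, (sg (e (k.succAbove j)) * (x (k.succAbove j) * zz x e (k.succAbove j)) ^ c)) *
      (∏ j, (zz x e (k.succAbove j) + y * (x (k.succAbove j) * zz x e (k.succAbove j)))) * R

lemma OO_zero {n : ℕ} (y : F) (x : Fin (n + 1) → F) : OO 0 y x = 0 := by
  have h := det_expand x (fun i : Fin (n + 1) => ((Fin.rev i : Fin (n + 1)) : ℕ))
  rw [Matrix.det_eq_zero_of_row_eq_zero (Fin.last n) (by intro j; simp)] at h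
  simp only [det_V] at h
  unfold OO
  simp only [pow_zero, mul_one, Finset.prod_mul_distrib]
  calc _ = (∑ e : Fin (n + 1) → Bool, (∏ j, sg (e j)) * V (zz x e)) *
      ((∏ j, ((x j)⁻¹ + y)) / B x) := by
        rw [Finset.sum_mul]
        exact Finset.sum_congr rfl fun e _ => by ring
    _ = 0 := by rw [← h, zero_mul]

/-- number of odd parts -/
def oddc {n : ℕ} (ν : Fin n → ℕ) : ℕ := (Finset.univ.filter (fun i : Fin n => Odd (ν i))).card

/-- alternant -/
def alt {n : ℕ} (ν : Fin n → ℕ) (x : Fin n → F) : F :=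
  Matrix.det (Matrix.of fun i j : Fin n => x j ^ (ν i + ((Fin.rev i : Fin n) : ℕ)))

/-- sum side -/
def AA {n : ℕ} (m : ℕ) (y : F) (x : Fin n → F) : F :=
  ∑ ν ∈ ((Fintype.piFinset fun _ : Fin n => Finset.range m).filter (fun ν => Antitone ν)),
    y ^ oddc ν * alt ν x

lemma alt_cons {n : ℕ} (m : ℕ) (ν : Fin n → ℕ) (x : Fin (n + 1) → F) :
    alt (Fin.cons m ν : Fin (n + 1) → ℕ) x = ∑ k : Fin (n + 1), (-1) ^ (k : ℕ) * x k ^ (m + n) *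
      alt ν (fun j => x (k.succAbove j)) := by
  unfold alt
  rw [Matrix.det_succ_row_zero]
  refine Finset.sum_congr rfl fun k _ => ?_
  congr 2
  ext i j
  simp

lemma oddc_cons {n : ℕ} (m : ℕ) (ν : Fin n → ℕ) :
    oddc (Fin.cons m ν : Fin (n + 1) → ℕ) = (if Odd m then 1 else 0) + oddc ν := by
  unfold oddc
  rw [Finset.card_filter, Fin.sum_univ_succ, Finset.card_filter]
  simp

lemma antitone_cons_iff {n : ℕ} (m : ℕ) (ν : Fin n → ℕ) :
    Antitone (Fin.cons m ν : Fin (n + 1) → ℕ) ↔ (∀ i, ν i ≤ m) ∧ Antitone ν := by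
  constructor
  · intro h
    refine ⟨fun i => by simpa using h (Fin.zero_le i.succ), fun i j hij => ?_⟩
    simpa using h (Fin.succ_le_succ_iff.2 hij)
  · rintro ⟨h1, h2⟩ i j hij
    induction i using Fin.cases with
    | zero =>
      induction j using Fin.cases with
      | zero => simp
      | succ j => simpa using h1 j
    | succ i =>
      induction j using Fin.cases with
      | zero => simp at hij
      | succ j => simpa using h2 (Fin.succ_le_succ_iff.1 hij)

lemma AA_step {n : ℕ} (m : ℕ) (y : F) (x : Fin (n + 1) → F) :
    AA (m + 1) y x = AA m y x + y ^ (if Odd m then 1 else 0) *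
      ∑ k : Fin (n + 1), (-1) ^ (k : ℕ) * x k ^ (m + n) *
        AA (m + 1) y (fun j => x (k.succAbove j)) := by
  have h1 : y ^ (if Odd m then 1 else 0) *
      ∑ k : Fin (n + 1), (-1) ^ (k : ℕ) * x k ^ (m + n) *
        AA (m + 1) y (fun j => x (k.succAbove j)) =
      ∑ ν ∈ ((Fintype.piFinset fun _ : Fin n => Finset.range (m + 1)).filter
        (fun ν => Antitone ν)), y ^ oddc (Fin.cons m ν : Fin (n + 1) → ℕ) *
          alt (Fin.cons m ν : Fin (n + 1) → ℕ) x := by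
    simp only [AA, alt_cons, oddc_cons, Finset.mul_sum, pow_add]
    rw [Finset.sum_comm]
    refine Finset.sum_congr rfl fun ν _ => Finset.sum_congr rfl fun k _ => ?_
    ring
  rw [h1]
  unfold AA
  rw [← Finset.sum_filter_not_add_sum_filter _ (fun ν : Fin (n + 1) → ℕ => ν 0 = m)]
  congr 1
  · refine Finset.sum_congr ?_ fun _ _ => rfl
    ext ν
    simp only [Finset.mem_filter, Fintype.mem_piFinset, Finset.mem_range]
    constructor
    · rintro ⟨⟨h1, h2⟩, h3⟩
      refine ⟨fun i => ?_, h2⟩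
      have := h2 (Fin.zero_le i)
      have := h1 0
      omega
    · rintro ⟨h1, h2⟩
      refine ⟨⟨fun i => ?_, h2⟩, ?_⟩
      · have := h1 i
        omega
      · have := h1 0
        omega
  · refine Finset.sum_nbij' (fun ν => Fin.tail ν) (fun ν => Fin.cons m ν) ?_ ?_ ?_ ?_ ?_
    · intro ν hν
      simp only [Finset.mem_filter, Fintype.mem_piFinset, Finset.mem_range] at hν ⊢
      obtain ⟨⟨h1, h2⟩, h3⟩ := hν
      refine ⟨fun i => h1 _, fun i j hij => h2 (Fin.succ_le_succ_iff.2 hij)⟩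
    · intro ν hν
      simp only [Finset.mem_filter, Fintype.mem_piFinset, Finset.mem_range] at hν ⊢
      obtain ⟨h1, h2⟩ := hν
      refine ⟨⟨fun i => ?_, (antitone_cons_iff m ν).2 ⟨fun i => Nat.lt_succ_iff.1 (h1 i), h2⟩⟩, rfl⟩
      induction i using Fin.cases with
      | zero => simp
      | succ i => simpa using h1 i
    · intro ν hν
      simp only [Finset.mem_filter] at hν
      rw [← hν.2]
      exact Fin.cons_self_tail ν
    · intro ν _
      exact Fin.tail_cons _ _
    · intro ν hν
      simp only [Finset.mem_filter] at hν
      have : (Fin.cons m (Fin.tail ν) : Fin (n + 1) → ℕ) = ν := by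
        rw [← hν.2]
        exact Fin.cons_self_tail ν
      rw [this]

lemma AA_zero {n : ℕ} (y : F) (x : Fin (n + 1) → F) : AA 0 y x = 0 := by
  unfold AA
  apply Finset.sum_eq_zero
  intro ν hν
  simp only [Finset.mem_filter, Fintype.mem_piFinset] at hν
  simpa using hν.1 0

lemma AA_nil (m : ℕ) (y : F) (x : Fin 0 → F) : AA m y x = 1 := by
  unfold AA
  have : ((Fintype.piFinset fun _ : Fin 0 => Finset.range m).filter (fun ν => Antitone ν)) =
      Finset.univ := by
    ext ν
    simp [Subsingleton.antitone]
  rw [this]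
  simp [oddc, alt]

lemma main_eq {n : ℕ} : ∀ (x : Fin n → F), Good x → ∀ (y : F) (c : ℕ),
    AA (2 * c) y x = OO c y x ∧ AA (2 * c + 1) y x = EE c y x := by
  induction n with
  | zero =>
    intro x _ y c
    rw [AA_nil, AA_nil]
    simp [OO, EE, V, B, pp]
  | succ n ih =>
    intro x hx y c
    have even : ∀ c, AA (2 * c) y x = OO c y x → AA (2 * c + 1) y x = EE c y x := by
      intro c h
      rw [AA_step, EE_step hx, h]
      simp only [(ih _ (hx.sA _) y c).2]
      simp
    have odd : ∀ c, AA (2 * c) y x = OO c y x := by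
      intro c
      induction c with
      | zero => rw [mul_zero, AA_zero, OO_zero]
      | succ c ihc =>
        have h2 : 2 * (c + 1) = 2 * c + 1 + 1 := by ring
        have h3 : ∀ k : Fin (n + 1), AA (2 * c + 1 + 1) y (fun j => x (k.succAbove j)) =
            OO (c + 1) y (fun j => x (k.succAbove j)) := by
          intro k
          rw [← h2]
          exact (ih _ (hx.sA k) y (c + 1)).1
        rw [h2, AA_step, OO_step hx, even c ihc]
        simp only [h3]
        simp
    exact ⟨odd c, even c (odd c)⟩

/-- numerators -/
def NN {n : ℕ} (c : ℕ) (r : Fin (n + 1)) (x : Fin n → F) : F :=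
  Matrix.det (Matrix.of fun i j : Fin n => x j ^ (c + (Fin.rev (r.succAbove i) : ℕ)) -
    ((x j)⁻¹) ^ (c + (Fin.rev (r.succAbove i) : ℕ)))

lemma vand_expand {n : ℕ} (z : Fin n → F) (y : F) :
    ∑ r : Fin (n + 1), y ^ (Fin.rev r : ℕ) *
      Matrix.det (Matrix.of fun i j : Fin n => z j ^ (Fin.rev (r.succAbove i) : ℕ)) =
    (∏ j, (z j + y)) * V z := by
  have h := det_V (Fin.cons (-y) z : Fin (n + 1) → F)
  rw [V_succAbove _ 0, Matrix.det_succ_column_zero] at h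
  simp only [Fin.cons_zero, Fin.val_zero, pow_zero, one_mul, Fin.zero_succAbove, Fin.cons_succ,
    Matrix.of_apply] at h
  have s1 : ∏ j, (-y - z j) = (-1) ^ n * ∏ j, (z j + y) := by
    have : ((-1) ^ n : F) = ∏ _j : Fin n, (-1) := by simp
    rw [this, ← Finset.prod_mul_distrib]
    exact Finset.prod_congr rfl fun j _ => by ring
  rw [s1, mul_assoc] at h
  have h1 : ((-1) ^ n : F) ≠ 0 := by simp
  apply mul_left_cancel₀ h1
  rw [← h, Finset.mul_sum]
  refine Finset.sum_congr rfl fun r _ => ?_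
  have e1 : (-y) ^ (Fin.rev r : ℕ) = (-1) ^ (Fin.rev r : ℕ) * y ^ (Fin.rev r : ℕ) := by
    rw [← mul_pow]; simp
  have e2 : ((-1) ^ n : F) = (-1) ^ (r : ℕ) * (-1) ^ (Fin.rev r : ℕ) := by
    rw [← pow_add]
    congr 1
    rw [Fin.val_rev]
    have := r.isLt
    omega
  rw [e1, e2]
  have e3 : (Matrix.of fun i j : Fin (n + 1) =>
      (Fin.cons (-y) z : Fin (n + 1) → F) j ^ (Fin.rev i : ℕ)).submatrix r.succAbove Fin.succ =
      Matrix.of fun i j : Fin n => z j ^ (Fin.rev (r.succAbove i) : ℕ) := by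
    ext i j
    simp
  rw [e3]
  ring

lemma EE_eq {n : ℕ} {x : Fin n → F} (c : ℕ) (y : F) :
    EE c y x = (∏ j, x j) ^ c * (∑ r : Fin (n + 1), y ^ (Fin.rev r : ℕ) * NN c r x) / B x := by
  have h1 : ∀ r : Fin (n + 1), NN c r x = ∑ e : Fin n → Bool, (∏ j, sg (e j)) *
      ((∏ j, zz x e j ^ c) *
        Matrix.det (Matrix.of fun i j : Fin n => zz x e j ^ (Fin.rev (r.succAbove i) : ℕ))) := by
    intro r
    unfold NN
    rw [det_expand]
    refine Finset.sum_congr rfl fun e _ => ?_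
    rw [← Matrix.det_mul_row (fun j => zz x e j ^ c)]
    refine congrArg (fun M : Matrix (Fin n) (Fin n) F => (∏ j, sg (e j)) * Matrix.det M) ?_
    ext i j
    simp [pow_add]
  have h2 : ∑ r : Fin (n + 1), y ^ (Fin.rev r : ℕ) * NN c r x =
      ∑ e : Fin n → Bool, (∏ j, sg (e j)) * (∏ j, zz x e j ^ c) *
        ((∏ j, (zz x e j + y)) * V (zz x e)) := by
    simp only [h1, ← vand_expand, Finset.mul_sum]
    rw [Finset.sum_comm]
    refine Finset.sum_congr rfl fun e _ => Finset.sum_congr rfl fun r _ => ?_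
    ring
  rw [h2, EE, Finset.mul_sum, Finset.sum_div]
  refine Finset.sum_congr rfl fun e _ => ?_
  simp only [Finset.prod_mul_distrib, mul_pow, Finset.prod_pow]
  ring

lemma hpoly_nat {R : Type} [CommRing R] {N : ℕ} (x : Fin N → R) (m : ℕ) :
    hpoly x (m : ℤ) = ∑ f ∈ Finset.univ.filter (fun f : Fin m → Fin N => Monotone f),
      ∏ i, x (f i) := by
  unfold hpoly
  rw [if_pos (Int.natCast_nonneg m)]
  rfl

lemma hpoly_neg {R : Type} [CommRing R] {N : ℕ} (x : Fin N → R) (m : ℤ) (hm : m < 0) :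
    hpoly x m = 0 := by
  unfold hpoly
  rw [if_neg (by omega)]

lemma hpoly_zero {R : Type} [CommRing R] {N : ℕ} (x : Fin N → R) : hpoly x 0 = 1 := by
  have := hpoly_nat x 0
  rw [Nat.cast_zero] at this
  rw [this]
  have h : (Finset.univ.filter (fun f : Fin 0 → Fin N => Monotone f)) = Finset.univ := by
    ext f
    simp [Subsingleton.monotone]
  rw [h]
  simp

lemma monotone_cons_zero {N m : ℕ} (f : Fin m → Fin (N + 1)) :
    Monotone (Fin.cons 0 f : Fin (m + 1) → Fin (N + 1)) ↔ Monotone f := by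
  constructor
  · intro h i j hij
    simpa using h (Fin.succ_le_succ_iff.2 hij)
  · intro h i j hij
    induction i using Fin.cases with
    | zero => simp
    | succ i =>
      induction j using Fin.cases with
      | zero => simp at hij
      | succ j => simpa using h (Fin.succ_le_succ_iff.1 hij)

lemma hpoly_succ {R : Type} [CommRing R] {N : ℕ} (x : Fin (N + 1) → R) (m : ℕ) :
    hpoly x ((m + 1 : ℕ) : ℤ) = hpoly (fun j : Fin N => x j.succ) ((m + 1 : ℕ) : ℤ) +
      x 0 * hpoly x (m : ℤ) := by
  rw [hpoly_nat, hpoly_nat, hpoly_nat]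
  rw [← Finset.sum_filter_not_add_sum_filter _ (fun f : Fin (m + 1) → Fin (N + 1) => f 0 = 0)]
  congr 1
  · symm
    refine Finset.sum_bij (fun g _ i => (g i).succ) ?_ ?_ ?_ ?_
    · intro g hg
      simp only [Finset.mem_filter, Finset.mem_univ, true_and] at hg ⊢
      exact ⟨fun i j hij => Fin.succ_le_succ_iff.2 (hg hij), Fin.succ_ne_zero _⟩
    · intro g _ g' _ h
      funext i
      exact Fin.succ_injective _ (congrFun h i)
    · intro f hf
      simp only [Finset.mem_filter, Finset.mem_univ, true_and] at hf
      have hne : ∀ i, f i ≠ 0 := by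
        intro i hi
        apply hf.2
        have := hf.1 (Fin.zero_le i)
        rw [hi] at this
        exact Fin.le_zero_iff.1 this
      refine ⟨fun i => (f i).pred (hne i), ?_, ?_⟩
      · simp only [Finset.mem_filter, Finset.mem_univ, true_and]
        intro i j hij
        exact Fin.pred_le_pred_iff.2 (hf.1 hij)
      · funext i
        simp
    · intro g _
      rfl
  · rw [Finset.mul_sum]
    refine Finset.sum_nbij' (fun f => Fin.tail f) (fun f => Fin.cons 0 f) ?_ ?_ ?_ ?_ ?_
    · intro f hf
      simp only [Finset.mem_filter, Finset.mem_univ, true_and] at hf ⊢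
      intro i j hij
      exact hf.1 (Fin.succ_le_succ_iff.2 hij)
    · intro f hf
      simp only [Finset.mem_filter, Finset.mem_univ, true_and] at hf ⊢
      exact ⟨(monotone_cons_zero f).2 hf, rfl⟩
    · intro f hf
      simp only [Finset.mem_filter] at hf
      rw [← hf.2]
      exact Fin.cons_self_tail f
    · intro f _
      exact Fin.tail_cons _ _
    · intro f hf
      simp only [Finset.mem_filter] at hf
      rw [Fin.prod_univ_succ, hf.2]
      rfl

lemma hpoly_nil {R : Type} [CommRing R] (x : Fin 0 → R) (m : ℕ) :
    hpoly x ((m : ℤ) + 1) = 0 := by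
  have := hpoly_nat x (m + 1)
  push_cast at this
  rw [this]
  apply Finset.sum_eq_zero
  intro f _
  exact (f 0).elim0

lemma hpoly_formula {N : ℕ} : ∀ (x : Fin N → F), Function.Injective x → ∀ m : ℕ,
    hpoly x ((m : ℤ) - N + 1) = ∑ l, x l ^ m / ∏ i ∈ Finset.univ.erase l, (x l - x i) := by
  induction N with
  | zero =>
    intro x _ m
    have := hpoly_nil x m
    simpa using this
  | succ N ih =>
    intro x hx m
    induction m with
    | zero =>
      have h := Lagrange.coeff_eq_sum (s := Finset.univ) (v := x) hx.injOn
        (P := (1 : Polynomial F)) (by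
          rw [Polynomial.degree_one, Finset.card_univ, Fintype.card_fin]
          exact_mod_cast Nat.succ_pos N)
      simp only [Polynomial.eval_one, Finset.card_univ, Fintype.card_fin, Nat.add_sub_cancel,
        Polynomial.coeff_one] at h
      simp only [pow_zero]
      rw [← h]
      split_ifs with hN
      · subst hN
        simpa using hpoly_zero x
      · apply hpoly_neg
        push_cast
        omega
    | succ m ihm =>
      have hx' : Function.Injective (fun j : Fin N => x j.succ) :=
        hx.comp (Fin.succ_injective _)
      have rec1 : hpoly x (((m + 1 : ℕ) : ℤ) - (N + 1 : ℕ) + 1) =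
          hpoly (fun j : Fin N => x j.succ) ((m : ℤ) - N + 1) +
          x 0 * hpoly x ((m : ℤ) - (N + 1 : ℕ) + 1) := by
        rcases lt_trichotomy ((m : ℤ) - N + 1) 0 with h | h | h
        · rw [hpoly_neg, hpoly_neg, hpoly_neg]
          · simp
          · push_cast; omega
          · omega
          · push_cast; omega
        · have e1 : (((m + 1 : ℕ) : ℤ) - (N + 1 : ℕ) + 1) = 0 := by push_cast; omega
          rw [e1, h, hpoly_zero, hpoly_zero, hpoly_neg]
          · simp
          · push_cast; omega
        · obtain ⟨t, ht⟩ := Int.eq_ofNat_of_zero_le (show 0 ≤ (m : ℤ) - N by omega)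
          have e1 : (((m + 1 : ℕ) : ℤ) - (N + 1 : ℕ) + 1) = ((t + 1 : ℕ) : ℤ) := by
            push_cast; omega
          have e2 : ((m : ℤ) - N + 1) = ((t + 1 : ℕ) : ℤ) := by
            push_cast; omega
          have e3 : ((m : ℤ) - (N + 1 : ℕ) + 1) = (t : ℤ) := by
            push_cast; omega
          rw [e1, e2, e3, hpoly_succ]
      rw [rec1, ih _ hx', ihm, Fin.sum_univ_succ, Fin.sum_univ_succ (n := N), mul_add,
        add_left_comm, Finset.mul_sum, ← Finset.sum_add_distrib]
      congr 1
      · ring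
      · refine Finset.sum_congr rfl fun l _ => ?_
        have e1 : ∏ i ∈ Finset.univ.erase l.succ, (x l.succ - x i) =
            (x l.succ - x 0) * ∏ i ∈ Finset.univ.erase l, (x l.succ - x i.succ) := by
          have : (Finset.univ.erase l.succ : Finset (Fin (N + 1))) =
              Finset.cons 0 ((Finset.univ.erase l).map (Fin.succEmb N)) (by simp) := by
            ext i
            induction i using Fin.cases with
            | zero => simp [(Fin.succ_ne_zero l).symm]
            | succ i => simp
          rw [this, Finset.prod_cons, Finset.prod_map]
          rfl
        have h1 : x l.succ - x 0 ≠ 0 := sub_ne_zero.2 (hx.ne (Fin.succ_ne_zero l))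
        have h2 : ∏ i ∈ Finset.univ.erase l, (x l.succ - x i.succ) ≠ 0 := by
          refine Finset.prod_ne_zero_iff.2 fun i hi => sub_ne_zero.2 (hx'.ne ?_)
          exact (Finset.ne_of_mem_erase hi).symm
        rw [e1]
        field_simp
        ring

lemma schur_eq {n : ℕ} (x : Fin n → F) (hx : Function.Injective x) (ν : Fin n → ℕ) :
    schur (fun i => (ν i : ℤ)) x * V x = alt ν x := by
  let D : Matrix (Fin n) (Fin n) F :=
    Matrix.of fun l j => x l ^ (j : ℕ) / ∏ i ∈ Finset.univ.erase l, (x l - x i)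
  have key : ∀ ν : Fin n → ℕ, schur (fun i => (ν i : ℤ)) x = alt ν x * D.det := by
    intro ν
    unfold schur alt
    rw [← Matrix.det_mul]
    congr 1
    ext i j
    rw [Matrix.mul_apply]
    simp only [Matrix.of_apply, D]
    have := hpoly_formula x hx (ν i + (Fin.rev i : ℕ) + j)
    have e : ((ν i + (Fin.rev i : ℕ) + j : ℕ) : ℤ) - n + 1 = (ν i : ℤ) - (i : ℕ) + (j : ℕ) := by
      rw [Fin.val_rev]
      have := i.isLt
      omega
    rw [e] at this
    rw [this]
    refine Finset.sum_congr rfl fun l _ => ?_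
    rw [pow_add]
    ring
  have h0 : schur (fun i : Fin n => ((0 : ℕ) : ℤ)) x = 1 := by
    unfold schur
    rw [Matrix.det_of_isUpperTriangular]
    · apply Finset.prod_eq_one
      intro i _
      simp [hpoly_zero]
    · intro i j hij
      simp only [Matrix.of_apply]
      apply hpoly_neg
      have : (j : ℕ) < (i : ℕ) := hij
      push_cast
      omega
  have h1 : alt (fun _ : Fin n => 0) x = V x := by
    unfold alt
    simp only [zero_add]
    exact det_V x
  have h2 := key (fun _ => 0)
  rw [h0, h1] at h2
  rw [key ν, mul_assoc, mul_comm D.det, ← h2, mul_one]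

lemma gen_identity {n : ℕ} {x : Fin n → F} (h : Good x) (c : ℕ) (y : F) :
    ∑ ν ∈ ((Fintype.piFinset fun _ : Fin n => Finset.range (2 * c + 1)).filter
      (fun ν => Antitone ν)), y ^ oddc ν * schur (fun i => (ν i : ℤ)) x =
    (∏ j, x j) ^ c * (∑ r : Fin (n + 1), y ^ (Fin.rev r : ℕ) * NN c r x) / (B x * V x) := by
  have h1 := (main_eq x h y c).2
  rw [EE_eq] at h1
  have hV := V_ne h.inj
  rw [← div_div, ← h1, AA, Finset.sum_div]
  refine Finset.sum_congr rfl fun ν _ => ?_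
  rw [← schur_eq x h.inj]
  field_simp

lemma denom {n : ℕ} {x : Fin n → F} (h : Good x) : NN 0 (Fin.last n) x = B x * V x := by
  have h1 := (main_eq x h 0 0).2
  rw [EE_eq] at h1
  have hB := h.B_ne
  have h2 : AA (2 * 0 + 1) (0 : F) x = V x := by
    unfold AA
    have : ((Fintype.piFinset fun _ : Fin n => Finset.range (2 * 0 + 1)).filter
        (fun ν => Antitone ν)) = {fun _ => 0} := by
      ext ν
      simp only [Finset.mem_filter, Fintype.mem_piFinset, Finset.mem_range, Finset.mem_singleton]
      constructor
      · rintro ⟨h1, _⟩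
        funext i
        have := h1 i
        omega
      · rintro rfl
        exact ⟨fun _ => by simp, antitone_const⟩
    rw [this, Finset.sum_singleton, ← det_V]
    simp [oddc, alt]
  rw [h2, pow_zero, one_mul, Fin.sum_univ_castSucc] at h1
  have h3 : ∀ r : Fin n, (0 : F) ^ (Fin.rev (Fin.castSucc r) : ℕ) = 0 := by
    intro r
    apply zero_pow
    rw [Fin.rev_castSucc]
    simp
  simp only [h3, zero_mul, Finset.sum_const_zero, zero_add, Fin.rev_last, Fin.val_zero,
    pow_zero, one_mul] at h1
  rw [h1]
  field_simp

lemma coeff_identity [Infinite F] {n : ℕ} {x : Fin n → F} (h : Good x) (c : ℕ)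
    (r : Fin (n + 1)) :
    ∑ ν ∈ ((Fintype.piFinset fun _ : Fin n => Finset.range (2 * c + 1)).filter
      (fun ν => Antitone ν ∧ oddc ν = (Fin.rev r : ℕ))), schur (fun i => (ν i : ℤ)) x =
    (∏ j, x j) ^ c * (NN c r x / NN 0 (Fin.last n) x) := by
  let P : Polynomial F := ∑ ν ∈ ((Fintype.piFinset fun _ : Fin n =>
    Finset.range (2 * c + 1)).filter (fun ν => Antitone ν)),
      Polynomial.C (schur (fun i => (ν i : ℤ)) x) * Polynomial.X ^ oddc ν
  let Q : Polynomial F := ∑ r : Fin (n + 1),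
    Polynomial.C ((∏ j, x j) ^ c * (NN c r x / NN 0 (Fin.last n) x)) *
      Polynomial.X ^ (Fin.rev r : ℕ)
  have hPQ : P = Q := by
    apply Polynomial.funext
    intro y
    have := gen_identity h c y
    simp only [P, Q, Polynomial.eval_finsetSum, Polynomial.eval_mul, Polynomial.eval_C,
      Polynomial.eval_pow, Polynomial.eval_X, denom h]
    simp only [mul_comm _ (y ^ oddc _)]
    rw [this, Finset.mul_sum, Finset.sum_div]
    refine Finset.sum_congr rfl fun r _ => ?_
    ring
  have hc := congrArg (fun p => Polynomial.coeff p (Fin.rev r : ℕ)) hPQ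
  simp only [P, Q, Polynomial.finsetSum_coeff, Polynomial.coeff_C_mul, Polynomial.coeff_X_pow] at hc
  rw [← Finset.filter_filter, Finset.sum_filter]
  have e1 : ∀ s : Fin (n + 1), ((Fin.rev r : ℕ) = (Fin.rev s : ℕ)) ↔ s = r := by
    intro s
    rw [← Fin.ext_iff, Fin.rev_inj, eq_comm]
  simp only [e1, mul_ite, mul_one, mul_zero, Finset.sum_ite_eq', Finset.mem_univ, if_true] at hc
  rw [← hc]
  refine Finset.sum_congr rfl fun ν _ => ?_
  simp only [eq_comm]

lemma good_Xv (n : ℕ) : Good (Xv n) where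
  ne0 j := by
    unfold Xv
    rw [Ne, FaithfulSMul.algebraMap_eq_zero_iff]
    exact MvPolynomial.X_ne_zero j
  inj := (FaithfulSMul.algebraMap_injective _ _).comp MvPolynomial.X_injective
  mul i j := by
    unfold Xv
    rw [← map_mul]
    intro h
    rw [← map_one (algebraMap (MvPolynomial (Fin n) ℚ) (FF n))] at h
    have h2 := FaithfulSMul.algebraMap_injective _ _ h
    have h3 := congrArg (MvPolynomial.eval (fun _ => (0 : ℚ))) h2
    simp at h3

end NearRect

/-- `sp_{2n}((c^{n-p},(c-1)^p); x^{±1}) = (x_1⋯x_n)^{-c} ·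
∑_{ν ⊆ ((2c)^n), ν has exactly p odd parts} s_n(ν; x)`. -/
theorem spWeyl_nearly_rectangular_eq_sum_schur
    (n c p : ℕ) (hpn : p ≤ n) (hc : 1 ≤ p → 1 ≤ c) :
    spWeyl n (fun i : Fin n => if (i : ℕ) < n - p then (c : ℤ) else (c : ℤ) - 1) (Xv n)
      = (∏ i : Fin n, Xv n i) ^ (-(c : ℤ)) *
        ∑ ν ∈ ((Fintype.piFinset fun _ : Fin n => Finset.range (2 * c + 1)).filter
          (fun ν => Antitone ν ∧
            (Finset.univ.filter (fun i : Fin n => Odd (ν i))).card = p)),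
          schur (fun i => (ν i : ℤ)) (Xv n) := by
  have hg := NearRect.good_Xv n
  have : Infinite (FF n) := CharZero.infinite _
  have hr : n - p < n + 1 := by omega
  have key := NearRect.coeff_identity hg c ⟨n - p, hr⟩
  have hrev : ((Fin.rev (⟨n - p, hr⟩ : Fin (n + 1)) : Fin (n + 1)) : ℕ) = p := by
    rw [Fin.val_rev]
    simp only
    omega
  rw [hrev] at key
  have hP : (∏ i : Fin n, Xv n i) ≠ 0 := Finset.prod_ne_zero_iff.2 fun j _ => hg.ne0 j
  have hz : ∀ (a : FF n) (k : ℤ) (m : ℕ), k = m → a ^ k - a ^ (-k) = a ^ m - a⁻¹ ^ m := by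
    intro a k m h
    subst h
    rw [zpow_neg, zpow_natCast, inv_pow]
  have hN : spWeyl n (fun i : Fin n => if (i : ℕ) < n - p then (c : ℤ) else (c : ℤ) - 1) (Xv n) =
      NearRect.NN c ⟨n - p, hr⟩ (Xv n) / NearRect.NN 0 (Fin.last n) (Xv n) := by
    unfold spWeyl NearRect.NN
    congr 2
    · ext i j
      simp only [Matrix.of_apply]
      apply hz
      have := i.isLt
      rw [Fin.val_rev]
      by_cases hi : (i : ℕ) < n - p
      · rw [if_pos hi, Fin.succAbove_of_castSucc_lt _ _ (by simpa [Fin.lt_def] using hi)]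
        simp only [Fin.val_castSucc]
        omega
      · rw [if_neg hi, Fin.succAbove_of_le_castSucc _ _ (by simpa [Fin.le_def] using hi)]
        simp only [Fin.val_succ]
        omega
    · ext i j
      simp only [Matrix.of_apply]
      apply hz
      have := i.isLt
      rw [Fin.val_rev, Fin.succAbove_last]
      simp only [Fin.val_castSucc]
      omega
  rw [hN]
  have key2 : ∑ ν ∈ ((Fintype.piFinset fun _ : Fin n => Finset.range (2 * c + 1)).filter
          (fun ν => Antitone ν ∧
            (Finset.univ.filter (fun i : Fin n => Odd (ν i))).card = p)),
          schur (fun i => (ν i : ℤ)) (Xv n) = (∏ j, Xv n j) ^ c *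
      (NearRect.NN c ⟨n - p, hr⟩ (Xv n) / NearRect.NN 0 (Fin.last n) (Xv n)) := by
    rw [← key]
    unfold NearRect.oddc
    refine Finset.sum_congr ?_ fun _ _ => rfl
    ext ν
    simp only [Finset.mem_filter]
  rw [key2, zpow_neg, zpow_natCast, ← mul_assoc, inv_mul_cancel₀ (pow_ne_zero _ hP), one_mul]

end
end
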